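/- For every ε ∈ [0,1/2], Randomized Single Elimination Bracket satisfies α₂^{RSEB}(𝒯^ε) = ε/3 + 2ε²/3. In particular, for every weakly ε-bounded independent probabilistic tournament T, every pair of teams S = {u,v}, and every T' that is S-adjacent to T, RSEB_S(T') − RSEB_S(T) ≤ ε/3 + 2ε²/3, and the supremum of such gains over all T ∈ 𝒯^ε, pairs S, and S-adjacent T' equals ε/3 + 2ε²/3. -/

import Mathlib

open scoped Classical
open Finset

/-! ## Basic tournament notions -/

/-- The set of potential matches among `n` teams: ordered pairs `(i, j)` with `i < j`. -/
abbrev MatchPair (n : ℕ) := {q : Fin n × Fin n // q.1 < q.2}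

/-- A deterministic (round robin) tournament on `n` teams: for each pair `i < j`,
`true` means that `i` beats `j`. -/
abbrev Outcome (n : ℕ) := MatchPair n → Bool

/-- `Outcome.beats o i j` holds when team `i` beats team `j` (it is `false` when `i = j`). -/
def Outcome.beats {n : ℕ} (o : Outcome n) (i j : Fin n) : Bool :=
  if h : i < j then o ⟨(i, j), h⟩
  else if h' : j < i then !o ⟨(j, i), h'⟩
  else false

/-- An independent probabilistic tournament on `n` teams: `p i j` is the probability
that `i` beats `j`, with `p i j + p j i = 1` for `i ≠ j`. -/
structure ProbTournament (n : ℕ) where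
  p : Fin n → Fin n → ℝ
  mem_Icc : ∀ i j : Fin n, p i j ∈ Set.Icc (0 : ℝ) 1
  compl : ∀ i j : Fin n, i ≠ j → p i j + p j i = 1

/-- The probability of the deterministic outcome `o` when all matches are independent
with probabilities given by `T`. -/
noncomputable def ProbTournament.prob {n : ℕ} (T : ProbTournament n) (o : Outcome n) : ℝ :=
  ∏ e : MatchPair n, (if o e then T.p e.val.1 e.val.2 else T.p e.val.2 e.val.1)

/-- `rP r T i`: the probability that team `i` wins when rule `r` is applied to the
independent probabilistic tournament `T`. -/
noncomputable def rP (r : ∀ n : ℕ, Outcome n → Fin n → ℝ) {n : ℕ}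
    (T : ProbTournament n) (i : Fin n) : ℝ :=
  ∑ o : Outcome n, T.prob o * r n o i

/-- `rPS r T S`: the probability that the winner lies in `S`. -/
noncomputable def rPS (r : ∀ n : ℕ, Outcome n → Fin n → ℝ) {n : ℕ}
    (T : ProbTournament n) (S : Finset (Fin n)) : ℝ :=
  ∑ i ∈ S, rP r T i

/-- A tournament rule assigns a probability distribution over the teams to every
deterministic tournament. -/
def IsTournamentRule (r : ∀ n : ℕ, Outcome n → Fin n → ℝ) : Prop :=
  (∀ (n : ℕ) (o : Outcome n) (i : Fin n), 0 ≤ r n o i) ∧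
  (∀ n : ℕ, 0 < n → ∀ o : Outcome n, ∑ i : Fin n, r n o i = 1)

/-- A rule is Condorcet-consistent if an undefeated team wins with probability 1. -/
def CondorcetConsistent (r : ∀ n : ℕ, Outcome n → Fin n → ℝ) : Prop :=
  ∀ (n : ℕ) (o : Outcome n) (i : Fin n),
    (∀ j : Fin n, j ≠ i → Outcome.beats o i j = true) → r n o i = 1

/-- Two independent probabilistic tournaments are `S`-adjacent if they agree on every
match that is not between two members of `S`. -/
def Adjacent {n : ℕ} (S : Finset (Fin n)) (T T' : ProbTournament n) : Prop :=
  ∀ i j : Fin n, ¬(i ∈ S ∧ j ∈ S) → T.p i j = T'.p i j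

/-- Weakly ε-bounded: all match probabilities lie in `[1/2 - ε, 1/2 + ε]`. -/
def WeaklyBounded (ε : ℝ) (n : ℕ) (T : ProbTournament n) : Prop :=
  ∀ i j : Fin n, i ≠ j → T.p i j ∈ Set.Icc (1/2 - ε) (1/2 + ε)

/-- Strictly ε-bounded: all match probabilities lie in `{1/2 - ε, 1/2 + ε}`. -/
def StrictlyBounded (ε : ℝ) (n : ℕ) (T : ProbTournament n) : Prop :=
  ∀ i j : Fin n, i ≠ j → T.p i j = 1/2 - ε ∨ T.p i j = 1/2 + ε

/-- `alph r k C`: the manipulability `α_k^r(C)`, i.e. the supremum over tournaments in the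
class `C` (on any number of teams), sets `S` of at most `k` teams, and `S`-adjacent
manipulations `T'`, of the gain `r_S(T') - r_S(T)`. -/
noncomputable def alph (r : ∀ n : ℕ, Outcome n → Fin n → ℝ) (k : ℕ)
    (C : ∀ n : ℕ, ProbTournament n → Prop) : ℝ :=
  sSup {x : ℝ | ∃ (n : ℕ) (T T' : ProbTournament n) (S : Finset (Fin n)),
    C n T ∧ S.card ≤ k ∧ Adjacent S T T' ∧ x = rPS r T' S - rPS r T S}

/-! ## Anonymity -/

/-- The relabeling of an outcome by a permutation `σ`: in `permOutcome σ o`,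
team `σ i` beats team `σ j` exactly when `i` beats `j` in `o`. -/
def permOutcome {n : ℕ} (σ : Equiv.Perm (Fin n)) (o : Outcome n) : Outcome n :=
  fun e => Outcome.beats o (σ.symm e.val.1) (σ.symm e.val.2)

/-- A tournament rule is anonymous if relabeling the teams relabels the winner
distribution accordingly. -/
def IsAnonymous (r : ∀ n : ℕ, Outcome n → Fin n → ℝ) : Prop :=
  ∀ (n : ℕ) (σ : Equiv.Perm (Fin n)) (o : Outcome n) (i : Fin n),
    r n (permOutcome σ o) (σ i) = r n o i

/-! ## Elimination rules and recursive tournament rules -/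

/-- An elimination rule: for every number `n > 1` of teams, a distribution `d n` over
sets `M` of matches to be played, with `1 ≤ |M| ≤ n - 1` on the support. -/
structure ElimRule where
  d : ∀ n : ℕ, Finset (MatchPair n) → ℝ
  nonneg : ∀ (n : ℕ) (M : Finset (MatchPair n)), 0 ≤ d n M
  sum_one : ∀ n : ℕ, 1 < n → ∑ M : Finset (MatchPair n), d n M = 1
  supp : ∀ (n : ℕ) (M : Finset (MatchPair n)), 1 < n → d n M ≠ 0 →
    1 ≤ M.card ∧ M.card ≤ n - 1

/-- A set of matches is a matching when no team appears in two distinct matches. -/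
def IsMatchingSet {n : ℕ} (M : Finset (MatchPair n)) : Prop :=
  ∀ e ∈ M, ∀ e' ∈ M, e ≠ e' →
    e.val.1 ≠ e'.val.1 ∧ e.val.1 ≠ e'.val.2 ∧ e.val.2 ≠ e'.val.1 ∧ e.val.2 ≠ e'.val.2

/-- A matching elimination rule only ever selects matchings. -/
def ElimRule.IsMatchingRule (E : ElimRule) : Prop :=
  ∀ (n : ℕ) (M : Finset (MatchPair n)), E.d n M ≠ 0 → IsMatchingSet M

/-- Team `i` loses one of the matches in `M` under the outcome `o`. -/
def losesIn {n : ℕ} (o : Outcome n) (M : Finset (MatchPair n)) (i : Fin n) : Prop :=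
  ∃ e ∈ M, (e.val.1 = i ∧ Outcome.beats o e.val.2 i = true) ∨
           (e.val.2 = i ∧ Outcome.beats o e.val.1 i = true)

/-- The teams surviving the matches `M` (i.e. not losing any match of `M`). -/
noncomputable def survivors {n : ℕ} (o : Outcome n) (M : Finset (MatchPair n)) :
    Finset (Fin n) :=
  Finset.univ.filter (fun i => ¬ losesIn o M i)

/-- The induced sub-outcome on the teams of `s`, reindexed by `Fin s.card` in
increasing order. -/
noncomputable def restrictOutcome {n : ℕ} (o : Outcome n) (s : Finset (Fin n)) :
    Outcome s.card :=
  fun e => Outcome.beats o (↑(s.orderIsoOfFin rfl e.val.1)) (↑(s.orderIsoOfFin rfl e.val.2))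

/-- The induced probabilistic subtournament on the teams of `s` (same match
probabilities), reindexed by `Fin s.card` in increasing order. -/
noncomputable def restrictProb {n : ℕ} (T : ProbTournament n) (s : Finset (Fin n)) :
    ProbTournament s.card where
  p a b := T.p ↑(s.orderIsoOfFin rfl a) ↑(s.orderIsoOfFin rfl b)
  mem_Icc _ _ := T.mem_Icc _ _
  compl a b hab := T.compl _ _
    (fun h => hab ((s.orderIsoOfFin rfl).injective (Subtype.coe_injective h)))

/-- The subset of `Fin s.card` corresponding to the members of `S` that lie in `s`. -/
noncomputable def mapTeams {n : ℕ} (s : Finset (Fin n)) (S : Finset (Fin n)) :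
    Finset (Fin s.card) :=
  Finset.univ.filter (fun a => (↑(s.orderIsoOfFin rfl a) : Fin n) ∈ S)

/-- Fueled recursion computing the winner distribution of the recursive tournament rule
`r^E`: sample `M ← E(n)`, eliminate all losers of matches in `M`, recurse on survivors. -/
noncomputable def recWinAux (E : ElimRule) : ℕ → ∀ n : ℕ, Outcome n → Fin n → ℝ
  | 0, n, _, _ => if n = 1 then 1 else 0
  | fuel + 1, n, o, i =>
    if n ≤ 1 then (if n = 1 then 1 else 0)
    else ∑ M : Finset (MatchPair n), E.d n M *
      (if h : i ∈ survivors o M then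
        recWinAux E fuel (survivors o M).card (restrictOutcome o (survivors o M))
          (((survivors o M).orderIsoOfFin rfl).symm ⟨i, h⟩)
      else 0)

/-- The recursive tournament rule `r^E` determined by the elimination rule `E`. -/
noncomputable def recWin (E : ElimRule) : ∀ n : ℕ, Outcome n → Fin n → ℝ :=
  fun n => recWinAux E n n

/-- `matchMem M u v`: the match between `u` and `v` belongs to `M`. -/
def matchMem {n : ℕ} (M : Finset (MatchPair n)) (u v : Fin n) : Prop :=
  ∃ e ∈ M, e.val = (u, v) ∨ e.val = (v, u)

/-- `valAfter r T M S`: the expected probability that the winner lies in `S` when the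
matches in `M` are played with outcomes drawn from `T`, the losers are eliminated, and
`r` is then run on the induced probabilistic subtournament `T|_M` of the survivors
(with the convention that eliminated teams win with probability `0`). -/
noncomputable def valAfter (r : ∀ n : ℕ, Outcome n → Fin n → ℝ) {n : ℕ}
    (T : ProbTournament n) (M : Finset (MatchPair n)) (S : Finset (Fin n)) : ℝ :=
  ∑ o : Outcome n, T.prob o *
    rPS r (restrictProb T (survivors o M)) (mapTeams (survivors o M) S)

/-- `U` is a base case for the manipulating coalition `S` under rule `r`:
no `S`-adjacent manipulation gains anything, i.e. `α_S^r(U) = 0`. -/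
def IsBaseCase (r : ∀ n : ℕ, Outcome n → Fin n → ℝ) {m : ℕ}
    (U : ProbTournament m) (S : Finset (Fin m)) : Prop :=
  ∀ U' : ProbTournament m, Adjacent S U U' → rPS r U' S - rPS r U S ≤ 0

/-! ## Gauntlets -/

/-- The tournament obtained from `o` by letting `u` beat every other team, keeping all
other matches intact. -/
def condorcetify {n : ℕ} (o : Outcome n) (u : Fin n) : Outcome n :=
  fun e => if e.val.1 = u then true else if e.val.2 = u then false else o e

/-- The opponents of `u` among the matches in `M`. -/
noncomputable def opponents {n : ℕ} (M : Finset (MatchPair n)) (u : Fin n) :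
    Finset (Fin n) :=
  (M.filter (fun e => e.val.1 = u)).image (fun e => e.val.2) ∪
  (M.filter (fun e => e.val.2 = u)).image (fun e => e.val.1)

/-- Fueled recursion for the distribution of the gauntlet of `u`: the set of opponents
that `u` plays in elimination matches when `r^E` is executed on a tournament in which
`u` beats everybody (the input `o` is assumed already so modified).  The value is the
probability, over the internal randomness of `E`, that the gauntlet equals `g`
(recorded as a set of teams of the outermost tournament). -/
noncomputable def gauntletDistAux (E : ElimRule) :
    ℕ → ∀ n : ℕ, Outcome n → Fin n → Finset (Fin n) → ℝ
  | 0, _, _, _, g => if g = ∅ then 1 else 0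
  | fuel + 1, n, o, u, g =>
    if n ≤ 1 then (if g = ∅ then 1 else 0)
    else ∑ M : Finset (MatchPair n), E.d n M *
      (if h : u ∈ survivors o M ∧ opponents M u ⊆ g ∧ g \ opponents M u ⊆ survivors o M then
        gauntletDistAux E fuel (survivors o M).card (restrictOutcome o (survivors o M))
          (((survivors o M).orderIsoOfFin rfl).symm ⟨u, h.1⟩)
          (Finset.univ.filter (fun a =>
            (↑((survivors o M).orderIsoOfFin rfl a) : Fin n) ∈ g \ opponents M u))
      else 0)

/-- `gauntletDist E n o u g`: the probability that the gauntlet `G^{r^E}_u(o)` of team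
`u` in the deterministic tournament `o` equals the set `g`. -/
noncomputable def gauntletDist (E : ElimRule) (n : ℕ) (o : Outcome n) (u : Fin n)
    (g : Finset (Fin n)) : ℝ :=
  gauntletDistAux E n n (condorcetify o u) u g

/-- `gauntletProbP E T u g`: the probability that the gauntlet `G^{r^E}_u(T)` of team `u`
in the independent probabilistic tournament `T` equals the set `g` (first sampling a
deterministic tournament from `T`, then the gauntlet). -/
noncomputable def gauntletProbP (E : ElimRule) {n : ℕ} (T : ProbTournament n)
    (u : Fin n) (g : Finset (Fin n)) : ℝ :=
  ∑ o : Outcome n, T.prob o * gauntletDist E n o u g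

/-- Given the first-round outcome `o` and matches `M`, the probability that the gauntlet
of team `x` in the surviving probabilistic subtournament `T|_M` equals the set `g`
(where `g` is recorded with the original team labels). -/
noncomputable def gauntletEventProb (E : ElimRule) {n : ℕ} (T : ProbTournament n)
    (M : Finset (MatchPair n)) (x : Fin n) (g : Finset (Fin n)) (o : Outcome n) : ℝ :=
  if h : x ∈ survivors o M ∧ g ⊆ survivors o M then
    gauntletProbP E (restrictProb T (survivors o M))
      (((survivors o M).orderIsoOfFin rfl).symm ⟨x, h.1⟩)
      (Finset.univ.filter (fun a =>
        (↑((survivors o M).orderIsoOfFin rfl a) : Fin n) ∈ g))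
  else 0

/-! ## Randomized Death Match -/

/-- Fueled recursion for Randomized Death Match: pick one of the `n.choose 2` matches
uniformly at random, eliminate the loser, recurse. -/
noncomputable def RDMAux : ℕ → ∀ n : ℕ, Outcome n → Fin n → ℝ
  | 0, n, _, _ => if n = 1 then 1 else 0
  | fuel + 1, n, o, i =>
    if n ≤ 1 then (if n = 1 then 1 else 0)
    else ((n.choose 2 : ℝ))⁻¹ * ∑ e : MatchPair n,
      (if h : i ∈ survivors o {e} then
        RDMAux fuel (survivors o {e}).card (restrictOutcome o (survivors o {e}))
          (((survivors o {e}).orderIsoOfFin rfl).symm ⟨i, h⟩)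
      else 0)

/-- Randomized Death Match. -/
noncomputable def RDM : ∀ n : ℕ, Outcome n → Fin n → ℝ :=
  fun n => RDMAux n n

/-! ## Randomized Single Elimination Bracket -/

/-- `nextPow2 n = 2 ^ ⌈log₂ n⌉`. -/
def nextPow2 (n : ℕ) : ℕ := 2 ^ Nat.clog 2 n

/-- Extend a tournament on `n` teams to `nextPow2 n` teams by adding dummy teams that
lose to all original teams (among themselves, the dummy with lower index wins). -/
def extendOutcome {n : ℕ} (o : Outcome n) : Outcome (nextPow2 n) :=
  fun e =>
    if h : (e.val.2 : ℕ) < n then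
      Outcome.beats o ⟨(e.val.1 : ℕ), lt_trans (Fin.lt_def.mp e.2) h⟩ ⟨(e.val.2 : ℕ), h⟩
    else true

/-- Fueled recursion for Randomized Single Elimination Bracket (after dummies have been
added): pick a uniformly random maximum matching on the remaining teams, play those
matches, eliminate all losers, recurse. -/
noncomputable def RSEBAux : ℕ → ∀ n : ℕ, Outcome n → Fin n → ℝ
  | 0, n, _, _ => if n = 1 then 1 else 0
  | fuel + 1, n, o, i =>
    if n ≤ 1 then (if n = 1 then 1 else 0)
    else
      ((Finset.univ.filter
          (fun M : Finset (MatchPair n) => IsMatchingSet M ∧ M.card = n / 2)).card : ℝ)⁻¹ *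
        ∑ M ∈ Finset.univ.filter
            (fun M : Finset (MatchPair n) => IsMatchingSet M ∧ M.card = n / 2),
          (if h : i ∈ survivors o M then
            RSEBAux fuel (survivors o M).card (restrictOutcome o (survivors o M))
              (((survivors o M).orderIsoOfFin rfl).symm ⟨i, h⟩)
          else 0)

/-- Randomized Single Elimination Bracket. -/
noncomputable def RSEB : ∀ n : ℕ, Outcome n → Fin n → ℝ :=
  fun n o i =>
    RSEBAux (nextPow2 n) (nextPow2 n) (extendOutcome o)
      (Fin.castLE (Nat.le_pow_clog one_lt_two n) i)

/-! ## Statement -/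


/-! ## A cleaner deterministic model: perfect matchings as involutions -/

/-- Fixed-point-free involutions of `s`, extended by the identity. -/
noncomputable def Invo {n : ℕ} (s : Finset (Fin n)) : Finset (Fin n → Fin n) :=
  Finset.univ.filter (fun g => (∀ i, g (g i) = i) ∧ ∀ i, g i ≠ i ↔ i ∈ s)

theorem mem_Invo {n : ℕ} {s : Finset (Fin n)} {g : Fin n → Fin n} :
    g ∈ Invo s ↔ (∀ i, g (g i) = i) ∧ ∀ i, g i ≠ i ↔ i ∈ s := by
  simp [Invo]

theorem Invo_mem {n : ℕ} {s : Finset (Fin n)} {g : Fin n → Fin n} (hg : g ∈ Invo s)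
    {i : Fin n} (hi : i ∈ s) : g i ∈ s := by
  rw [mem_Invo] at hg
  rw [← hg.2] at hi ⊢
  rw [hg.1]
  exact hi.symm

/-- Survivors of the round `g` among the teams `s`. -/
noncomputable def sv {n : ℕ} (b : Fin n → Fin n → Bool) (g : Fin n → Fin n)
    (s : Finset (Fin n)) : Finset (Fin n) :=
  s.filter (fun i => b i (g i) = true)

/-- Winning probability in `k` rounds of random matchings. -/
noncomputable def winP {n : ℕ} : ℕ → Finset (Fin n) → (Fin n → Fin n → Bool) → Fin n → ℝ
  | 0, s, _, i => if i ∈ s then 1 else 0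
  | k + 1, s, b, i => ((Invo s).card : ℝ)⁻¹ * ∑ g ∈ Invo s, winP k (sv b g s) b i

theorem winP_zero_of_notMem {n : ℕ} (k : ℕ) : ∀ (s : Finset (Fin n)) (b : Fin n → Fin n → Bool)
    (i : Fin n), i ∉ s → winP k s b i = 0 := by
  induction k with
  | zero => intro s b i hi; simp [winP, hi]
  | succ k ih =>
    intro s b i hi
    rw [winP, Finset.sum_eq_zero, mul_zero]
    intro g hg
    apply ih
    simp [sv, hi]

/-- Transport of an involution along an embedding. -/
noncomputable def extG {n N : ℕ} (f : Fin n ↪ Fin N) (g : Fin n → Fin n) : Fin N → Fin N :=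
  Function.extend f (fun i => f (g i)) id

theorem extG_apply {n N : ℕ} (f : Fin n ↪ Fin N) (g : Fin n → Fin n) (i : Fin n) :
    extG f g (f i) = f (g i) := by
  simp [extG, f.injective.extend_apply]

theorem extG_of_not {n N : ℕ} (f : Fin n ↪ Fin N) (g : Fin n → Fin n) (j : Fin N)
    (h : ¬ ∃ i, f i = j) : extG f g j = j := by
  simp [extG, Function.extend_apply' _ _ _ h]

theorem extG_mem {n N : ℕ} (f : Fin n ↪ Fin N) (s : Finset (Fin n)) (g : Fin n → Fin n)
    (hg : g ∈ Invo s) : extG f g ∈ Invo (s.map f) := by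
  rw [mem_Invo] at hg ⊢
  constructor
  · intro j
    by_cases h : ∃ i, f i = j
    · obtain ⟨i, rfl⟩ := h
      rw [extG_apply, extG_apply, hg.1]
    · rw [extG_of_not f g j h, extG_of_not f g j h]
  · intro j
    by_cases h : ∃ i, f i = j
    · obtain ⟨i, rfl⟩ := h
      rw [extG_apply, Finset.mem_map' f, ← hg.2]
      simp
    · rw [extG_of_not f g j h]
      simp only [ne_eq, not_true_eq_false, Finset.mem_map, false_iff]
      rintro ⟨i, -, hi⟩
      exact h ⟨i, hi⟩

theorem extG_inj {n N : ℕ} (f : Fin n ↪ Fin N) : Function.Injective (extG f) := by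
  intro g g' h
  funext i
  have := congrFun h (f i)
  rw [extG_apply, extG_apply] at this
  exact f.injective this

theorem extG_surj {n N : ℕ} (f : Fin n ↪ Fin N) (s : Finset (Fin n)) (G : Fin N → Fin N)
    (hG : G ∈ Invo (s.map f)) : ∃ g ∈ Invo s, extG f g = G := by
  have key : ∀ i, ∃ i', f i' = G (f i) := by
    intro i
    by_cases hi : i ∈ s
    · have := Invo_mem hG ((Finset.mem_map' f).2 hi)
      rw [Finset.mem_map] at this
      obtain ⟨a, -, ha⟩ := this
      exact ⟨a, ha⟩
    · refine ⟨i, ?_⟩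
      by_contra hne
      exact hi ((Finset.mem_map' f).1 (((mem_Invo.1 hG).2 (f i)).1 (Ne.symm hne)))
  choose g hg using key
  have hG' := mem_Invo.1 hG
  refine ⟨g, ?_, ?_⟩
  · rw [mem_Invo]
    constructor
    · intro i
      apply f.injective
      rw [hg, hg, hG'.1]
    · intro i
      rw [← Finset.mem_map' f, ← hG'.2, ← hg]
      simp
  · funext j
    by_cases h : ∃ i, f i = j
    · obtain ⟨i, rfl⟩ := h
      rw [extG_apply, hg]
    · rw [extG_of_not f g j h]
      by_contra hne
      have := (hG'.2 j).1 (Ne.symm hne)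
      rw [Finset.mem_map] at this
      obtain ⟨a, -, ha⟩ := this
      exact h ⟨a, ha⟩

theorem sv_map {n N : ℕ} (f : Fin n ↪ Fin N) (b : Fin n → Fin n → Bool)
    (b' : Fin N → Fin N → Bool) (h : ∀ i j, b i j = b' (f i) (f j)) (g : Fin n → Fin n)
    (s : Finset (Fin n)) : sv b' (extG f g) (s.map f) = (sv b g s).map f := by
  ext j
  simp only [sv, Finset.mem_filter, Finset.mem_map]
  constructor
  · rintro ⟨⟨i, hi, rfl⟩, hb⟩
    rw [extG_apply, ← h] at hb
    exact ⟨i, ⟨hi, hb⟩, rfl⟩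
  · rintro ⟨i, ⟨hi, hb⟩, rfl⟩
    refine ⟨⟨i, hi, rfl⟩, ?_⟩
    rw [extG_apply, ← h]
    exact hb

theorem winP_map {n N : ℕ} (f : Fin n ↪ Fin N) (b : Fin n → Fin n → Bool)
    (b' : Fin N → Fin N → Bool) (h : ∀ i j, b i j = b' (f i) (f j)) (k : ℕ) :
    ∀ (s : Finset (Fin n)) (i : Fin n), winP k s b i = winP k (s.map f) b' (f i) := by
  induction k with
  | zero => intro s i; simp [winP]
  | succ k ih =>
    intro s i
    rw [winP, winP]
    have hsum : ∑ g ∈ Invo s, winP k (sv b g s) b i =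
        ∑ g ∈ Invo (s.map f), winP k (sv b' g (s.map f)) b' (f i) := by
      refine Finset.sum_bij (fun g _ => extG f g) (fun g hg => extG_mem f s g hg)
        (fun g _ g' _ h => extG_inj f h) ?_ ?_
      · intro G hG
        obtain ⟨g, hg, h⟩ := extG_surj f s G hG
        exact ⟨g, hg, h⟩
      · intro g hg
        rw [ih, sv_map f b b' h]
    have hcard : (Invo s).card = (Invo (s.map f)).card := by
      refine Finset.card_bij (fun g _ => extG f g) (fun g hg => extG_mem f s g hg)
        (fun g _ g' _ h => extG_inj f h) ?_
      intro G hG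
      obtain ⟨g, hg, h⟩ := extG_surj f s G hG
      exact ⟨g, hg, h⟩
    rw [hsum, hcard]

/-! ## Perfect matchings versus involutions -/

/-- The set of matches of an involution. -/
noncomputable def matchesOf {n : ℕ} (g : Fin n → Fin n) : Finset (MatchPair n) :=
  Finset.univ.filter (fun e => g e.val.1 = e.val.2)

theorem mem_matchesOf {n : ℕ} {g : Fin n → Fin n} {e : MatchPair n} :
    e ∈ matchesOf g ↔ g e.val.1 = e.val.2 := by
  simp [matchesOf]

theorem matchesOf_isMatching {n : ℕ} (g : Fin n → Fin n) (hg : ∀ i, g (g i) = i) :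
    IsMatchingSet (matchesOf g) := by
  intro e he e' he' hne
  rw [mem_matchesOf] at he he'
  have h2 : g e.val.2 = e.val.1 := by rw [← he, hg]
  have h2' : g e'.val.2 = e'.val.1 := by rw [← he', hg]
  have hlt := e.2
  have hlt' := e'.2
  refine ⟨?_, ?_, ?_, ?_⟩
  · intro h
    apply hne
    apply Subtype.ext
    apply Prod.ext h
    rw [← he, ← he', h]
  · intro h
    rw [h, h2'] at he
    rw [h, ← he] at hlt
    exact absurd hlt (not_lt.2 hlt'.le)
  · intro h
    rw [h, he'] at h2
    rw [h, ← h2] at hlt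
    exact absurd hlt (not_lt.2 hlt'.le)
  · intro h
    apply hne
    apply Subtype.ext
    refine Prod.ext ?_ h
    rw [← h2, ← h2', h]

/-- Endpoint map. -/
def endpt {n : ℕ} (M : Finset (MatchPair n)) (q : M × Bool) : Fin n :=
  if q.2 then q.1.1.val.1 else q.1.1.val.2

theorem endpt_inj {n : ℕ} (M : Finset (MatchPair n)) (hM : IsMatchingSet M) :
    Function.Injective (endpt M) := by
  rintro ⟨⟨e, he⟩, c⟩ ⟨⟨e', he'⟩, c'⟩ h
  by_cases hee : e = e'
  · subst hee
    have := e.2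
    cases c <;> cases c' <;> simp [endpt] at h ⊢
    · exact absurd h (ne_of_gt this)
    · exact absurd h (ne_of_lt this)
  · obtain ⟨h1, h2, h3, h4⟩ := hM e he e' he' hee
    cases c <;> cases c' <;> simp [endpt] at h
    · exact absurd h h4
    · exact absurd h h3
    · exact absurd h h2
    · exact absurd h h1

theorem matchesOf_card {n : ℕ} (g : Fin n → Fin n) (hg : g ∈ Invo (Finset.univ)) :
    (matchesOf g).card * 2 = n := by
  rw [mem_Invo] at hg
  have hinj := endpt_inj (matchesOf g) (matchesOf_isMatching g hg.1)
  have hsurj : Function.Surjective (endpt (matchesOf g)) := by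
    intro i
    have hne : g i ≠ i := (hg.2 i).2 (Finset.mem_univ i)
    rcases lt_or_gt_of_ne hne with h | h
    · refine ⟨(⟨⟨(g i, i), h⟩, mem_matchesOf.2 (hg.1 i)⟩, false), ?_⟩
      simp [endpt]
    · refine ⟨(⟨⟨(i, g i), h⟩, mem_matchesOf.2 rfl⟩, true), ?_⟩
      simp [endpt]
  have := Fintype.card_of_bijective ⟨hinj, hsurj⟩
  simpa using this

theorem matchesOf_inj {n : ℕ} (g g' : Fin n → Fin n) (hg : g ∈ Invo (Finset.univ))
    (hg' : g' ∈ Invo (Finset.univ)) (h : matchesOf g = matchesOf g') : g = g' := by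
  rw [mem_Invo] at hg hg'
  funext i
  have hne : g i ≠ i := (hg.2 i).2 (Finset.mem_univ i)
  rcases lt_or_gt_of_ne hne with hlt | hlt
  · have : (⟨(g i, i), hlt⟩ : MatchPair n) ∈ matchesOf g := mem_matchesOf.2 (hg.1 i)
    rw [h, mem_matchesOf] at this
    simp only at this
    rw [← this, hg'.1, this]
  · have : (⟨(i, g i), hlt⟩ : MatchPair n) ∈ matchesOf g := mem_matchesOf.2 rfl
    rw [h, mem_matchesOf] at this
    exact this.symm

theorem matchesOf_surj {n : ℕ} (M : Finset (MatchPair n)) (hM : IsMatchingSet M)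
    (hc : M.card * 2 = n) : ∃ g ∈ Invo (Finset.univ : Finset (Fin n)), matchesOf g = M := by
  have hinj := endpt_inj M hM
  have hbij : Function.Bijective (endpt M) := by
    rw [Fintype.bijective_iff_injective_and_card]
    exact ⟨hinj, by simpa using hc⟩
  let e := Equiv.ofBijective _ hbij
  let g : Fin n → Fin n := fun i => e ((e.symm i).1, !(e.symm i).2)
  have hgg : ∀ i, g (g i) = i := by
    intro i
    simp [g]
  have hne : ∀ i, g i ≠ i := by
    intro i h
    have : e ((e.symm i).1, !(e.symm i).2) = e (e.symm i) := by
      rw [Equiv.apply_symm_apply]; exact h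
    have h2 := congrArg Prod.snd (e.injective this)
    simp at h2
  have hsub : M ⊆ matchesOf g := by
    intro m hm
    rw [mem_matchesOf]
    have h1 : e (⟨m, hm⟩, true) = m.val.1 := by simp [e, endpt]
    have h2 : e (⟨m, hm⟩, false) = m.val.2 := by simp [e, endpt]
    have h3 : e.symm m.val.1 = (⟨m, hm⟩, true) := by rw [← h1, Equiv.symm_apply_apply]
    simp only [g, h3]
    exact h2
  have hmem : g ∈ Invo (Finset.univ : Finset (Fin n)) := by
    rw [mem_Invo]; exact ⟨hgg, fun i => by simp [hne i]⟩
  refine ⟨g, hmem, (Finset.eq_of_subset_of_card_le hsub ?_).symm⟩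
  have := matchesOf_card g hmem
  omega

theorem beats_compl {n : ℕ} (o : Outcome n) (i j : Fin n) (h : i ≠ j) :
    Outcome.beats o i j = !Outcome.beats o j i := by
  unfold Outcome.beats
  rcases lt_or_gt_of_ne h with h | h
  · simp [h, not_lt.2 h.le]
  · simp [h, not_lt.2 h.le]

theorem survivors_matchesOf {n : ℕ} (o : Outcome n) (g : Fin n → Fin n)
    (hg : g ∈ Invo (Finset.univ)) :
    survivors o (matchesOf g) = sv (Outcome.beats o) g Finset.univ := by
  rw [mem_Invo] at hg
  ext i
  simp only [survivors, sv, Finset.mem_filter, Finset.mem_univ, true_and]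
  have hne : g i ≠ i := (hg.2 i).2 (Finset.mem_univ i)
  rw [beats_compl o i (g i) hne.symm]
  have : losesIn o (matchesOf g) i ↔ Outcome.beats o (g i) i = true := by
    constructor
    · rintro ⟨e, he, ⟨rfl, hb⟩ | ⟨rfl, hb⟩⟩
      · rw [mem_matchesOf] at he
        rw [he]; exact hb
      · rw [mem_matchesOf] at he
        rw [← he, hg.1]
        rw [← he] at hb
        exact hb
    · intro hb
      rcases lt_or_gt_of_ne hne with h | h
      · exact ⟨⟨(g i, i), h⟩, mem_matchesOf.2 (hg.1 i), Or.inr ⟨rfl, hb⟩⟩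
      · exact ⟨⟨(i, g i), h⟩, mem_matchesOf.2 rfl, Or.inl ⟨rfl, hb⟩⟩
  rw [this]
  simp

theorem sv_card {n : ℕ} (o : Outcome n) (g : Fin n → Fin n)
    (hg : g ∈ Invo (Finset.univ)) :
    (sv (Outcome.beats o) g Finset.univ).card * 2 = n := by
  rw [mem_Invo] at hg
  have h1 : (sv (Outcome.beats o) g Finset.univ).card =
      ((sv (Outcome.beats o) g Finset.univ)ᶜ).card := by
    refine Finset.card_bij (fun i _ => g i) ?_ ?_ ?_
    · intro i hi
      simp only [sv, Finset.mem_filter, Finset.mem_univ, true_and, Finset.mem_compl] at hi ⊢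
      rw [hg.1, beats_compl o _ _ ((hg.2 i).2 (Finset.mem_univ i)), hi]
      simp
    · intro i _ j _ h
      rw [← hg.1 i, h, hg.1]
    · intro i hi
      refine ⟨g i, ?_, hg.1 i⟩
      simp only [sv, Finset.mem_filter, Finset.mem_univ, true_and, Finset.mem_compl] at hi ⊢
      rw [hg.1, beats_compl o _ _ ((hg.2 i).2 (Finset.mem_univ i))]
      simpa using hi
  have h2 := Finset.card_add_card_compl (sv (Outcome.beats o) g Finset.univ)
  rw [Fintype.card_fin] at h2
  omega

theorem beats_restrict {n : ℕ} (o : Outcome n) (s : Finset (Fin n)) (i j : Fin s.card) :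
    Outcome.beats (restrictOutcome o s) i j =
      Outcome.beats o (s.orderIsoOfFin rfl i) (s.orderIsoOfFin rfl j) := by
  rcases lt_trichotomy i j with h | h | h
  · conv_lhs => unfold Outcome.beats
    simp only [h, dif_pos]
    rfl
  · subst h
    simp [Outcome.beats]
  · rw [beats_compl _ _ _ h.ne']
    rw [beats_compl o _ _ (fun hh => h.ne' ((s.orderIsoOfFin rfl).injective (Subtype.ext hh)))]
    congr 1
    conv_lhs => unfold Outcome.beats
    simp only [h, dif_pos]
    rfl

theorem RSEBAux_eq_winP (k : ℕ) : ∀ (fuel n : ℕ) (o : Outcome n) (i : Fin n), k ≤ fuel →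
    n = 2 ^ k → RSEBAux fuel n o i = winP k Finset.univ (Outcome.beats o) i := by
  induction k with
  | zero =>
    intro fuel n o i _ hn
    simp only [pow_zero] at hn
    cases fuel <;> simp [RSEBAux, winP, hn]
  | succ k ih =>
    intro fuel n o i hf hn
    obtain ⟨fuel, rfl⟩ : ∃ f, fuel = f + 1 := ⟨fuel - 1, by omega⟩
    have hk : 0 < 2 ^ k := by positivity
    have hn2 : n = 2 ^ k * 2 := by rw [hn, pow_succ]
    have hn1 : ¬ n ≤ 1 := by omega
    have hdiv : n / 2 = 2 ^ k := by omega
    rw [RSEBAux, if_neg hn1, winP]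
    have hmem : ∀ g ∈ Invo (Finset.univ : Finset (Fin n)), matchesOf g ∈ Finset.univ.filter
        (fun M : Finset (MatchPair n) => IsMatchingSet M ∧ M.card = n / 2) := by
      intro g hg
      simp only [Finset.mem_filter, Finset.mem_univ, true_and]
      refine ⟨matchesOf_isMatching g (mem_Invo.1 hg).1, ?_⟩
      have := matchesOf_card g hg
      omega
    have hsurj : ∀ M ∈ Finset.univ.filter
        (fun M : Finset (MatchPair n) => IsMatchingSet M ∧ M.card = n / 2),
        ∃ g, ∃ _ : g ∈ Invo (Finset.univ : Finset (Fin n)), matchesOf g = M := by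
      intro M hM
      simp only [Finset.mem_filter, Finset.mem_univ, true_and] at hM
      obtain ⟨g, hg, h⟩ := matchesOf_surj M hM.1 (by omega)
      exact ⟨g, hg, h⟩
    have hcard : (Invo (Finset.univ : Finset (Fin n))).card = (Finset.univ.filter
        (fun M : Finset (MatchPair n) => IsMatchingSet M ∧ M.card = n / 2)).card :=
      Finset.card_bij (fun g _ => matchesOf g) hmem
        (fun g hg g' hg' h => matchesOf_inj g g' hg hg' h) hsurj
    rw [← hcard]
    congr 1
    symm
    refine Finset.sum_bij (fun g _ => matchesOf g) hmem
        (fun g hg g' hg' h => matchesOf_inj g g' hg hg' h) hsurj ?_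
    intro g hg
    have hs := survivors_matchesOf o g hg
    have hc := sv_card o g hg
    rw [← hs] at hc ⊢
    split_ifs with h
    · rw [ih fuel _ _ _ (by omega) (by omega)]
      have := winP_map ((Finset.orderEmbOfFin (survivors o (matchesOf g)) rfl).toEmbedding)
        (Outcome.beats (restrictOutcome o (survivors o (matchesOf g)))) (Outcome.beats o)
        (by intro a b; exact beats_restrict o _ a b) k Finset.univ
        (((survivors o (matchesOf g)).orderIsoOfFin rfl).symm ⟨i, h⟩)
      rw [this]
      congr 1
      · rw [Finset.map_eq_image]
        exact (Finset.image_orderEmbOfFin_univ _ rfl).symm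
      · simp [Finset.orderEmbOfFin]
    · exact winP_zero_of_notMem k _ _ i h

/-! ## Expectations over independent probabilistic tournaments -/

/-- Expectation. -/
noncomputable def Ex {n : ℕ} (T : ProbTournament n) (f : Outcome n → ℝ) : ℝ :=
  ∑ O : Outcome n, T.prob O * f O

/-- Weight of one match. -/
noncomputable def wt {n : ℕ} (T : ProbTournament n) (e : MatchPair n) (c : Bool) : ℝ :=
  if c then T.p e.val.1 e.val.2 else T.p e.val.2 e.val.1

theorem prob_eq {n : ℕ} (T : ProbTournament n) (O : Outcome n) :
    T.prob O = ∏ e, wt T e (O e) := rfl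

theorem wt_sum {n : ℕ} (T : ProbTournament n) (e : MatchPair n) :
    ∑ c : Bool, wt T e c = 1 := by
  simp [wt]
  exact T.compl _ _ (ne_of_lt e.2)

theorem wt_nonneg {n : ℕ} (T : ProbTournament n) (e : MatchPair n) (c : Bool) :
    0 ≤ wt T e c := by
  unfold wt
  split_ifs
  · exact (T.mem_Icc _ _).1
  · exact (T.mem_Icc _ _).1

theorem prob_nonneg {n : ℕ} (T : ProbTournament n) (O : Outcome n) : 0 ≤ T.prob O := by
  rw [prob_eq]
  exact Finset.prod_nonneg (fun e _ => wt_nonneg T e _)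

theorem Ex_prod {n : ℕ} (T : ProbTournament n) (φ : MatchPair n → Bool → ℝ) :
    Ex T (fun O => ∏ e, φ e (O e)) = ∏ e, ∑ c : Bool, wt T e c * φ e c := by
  rw [Finset.prod_univ_sum, Fintype.piFinset_univ]
  unfold Ex
  refine Finset.sum_congr rfl (fun O _ => ?_)
  rw [prob_eq, ← Finset.prod_mul_distrib]

theorem Ex_one {n : ℕ} (T : ProbTournament n) : Ex T (fun _ => 1) = 1 := by
  have := Ex_prod T (fun _ _ => 1)
  simp only [Finset.prod_const_one, mul_one, wt_sum] at this
  exact this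

theorem sum_prob {n : ℕ} (T : ProbTournament n) : ∑ O : Outcome n, T.prob O = 1 := by
  have := Ex_one T
  simpa [Ex] using this

theorem Ex_mono {n : ℕ} (T : ProbTournament n) (f g : Outcome n → ℝ) (h : ∀ O, f O ≤ g O) :
    Ex T f ≤ Ex T g :=
  Finset.sum_le_sum (fun O _ => mul_le_mul_of_nonneg_left (h O) (prob_nonneg T O))

theorem Ex_sum {n : ℕ} {ι : Type*} (T : ProbTournament n) (s : Finset ι)
    (f : ι → Outcome n → ℝ) : Ex T (fun O => ∑ a ∈ s, f a O) = ∑ a ∈ s, Ex T (f a) := by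
  unfold Ex
  rw [Finset.sum_comm]
  refine Finset.sum_congr rfl (fun O _ => ?_)
  rw [Finset.mul_sum]

theorem Ex_mul_left {n : ℕ} (T : ProbTournament n) (c : ℝ) (f : Outcome n → ℝ) :
    Ex T (fun O => c * f O) = c * Ex T f := by
  unfold Ex
  rw [Finset.mul_sum]
  refine Finset.sum_congr rfl (fun O _ => ?_)
  ring

/-- `f` only depends on the matches in `A`. -/
def DepOn {n : ℕ} (f : Outcome n → ℝ) (A : MatchPair n → Prop) : Prop :=
  ∀ O O' : Outcome n, (∀ e, A e → O e = O' e) → f O = f O'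

/-- Take `A` from `O`, the rest from `O'`. -/
noncomputable def mixO {n : ℕ} (A : MatchPair n → Prop) (O O' : Outcome n) : Outcome n :=
  fun e => if A e then O e else O' e

theorem Ex_indep {n : ℕ} (T : ProbTournament n) (A : MatchPair n → Prop)
    (f g : Outcome n → ℝ) (hf : DepOn f A) (hg : DepOn g (fun e => ¬ A e)) :
    Ex T (fun O => f O * g O) = Ex T f * Ex T g := by
  let Φ : Outcome n × Outcome n → Outcome n × Outcome n :=
    fun q => (mixO A q.1 q.2, mixO A q.2 q.1)
  have hΦ : Function.Involutive Φ := by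
    rintro ⟨O, O'⟩
    simp only [Φ, Prod.mk.injEq]
    constructor <;> funext e <;> by_cases h : A e <;> simp [mixO, h]
  have h1 : Ex T f * Ex T g =
      ∑ q : Outcome n × Outcome n, (T.prob q.1 * T.prob q.2) * (f q.1 * g q.2) := by
    unfold Ex
    rw [Finset.sum_mul_sum, Fintype.sum_prod_type]
    refine Finset.sum_congr rfl (fun O _ => Finset.sum_congr rfl (fun O' _ => ?_))
    ring
  have h2 : ∑ q : Outcome n × Outcome n, (T.prob q.1 * T.prob q.2) * (f q.1 * g q.1) =
      ∑ q : Outcome n × Outcome n, (T.prob q.1 * T.prob q.2) * (f q.1 * g q.2) := by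
    rw [← Equiv.sum_comp hΦ.toPerm]
    refine Finset.sum_congr rfl (fun q _ => ?_)
    obtain ⟨O, O'⟩ := q
    simp only [Function.Involutive.coe_toPerm, Φ]
    have e1 : T.prob (mixO A O O') * T.prob (mixO A O' O) = T.prob O * T.prob O' := by
      simp only [prob_eq, ← Finset.prod_mul_distrib]
      refine Finset.prod_congr rfl (fun e _ => ?_)
      by_cases h : A e <;> simp [mixO, h, mul_comm]
    have e2 : f (mixO A O O') = f O := hf _ _ (fun e he => by simp [mixO, he])
    have e3 : g (mixO A O O') = g O' := hg _ _ (fun e he => by simp [mixO, he])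
    rw [e1, e2, e3]
  rw [h1, ← h2, Fintype.sum_prod_type]
  unfold Ex
  refine Finset.sum_congr rfl (fun O _ => ?_)
  simp only
  rw [← Finset.sum_mul, ← Finset.mul_sum, sum_prob]
  ring

theorem Ex_single {n : ℕ} (T : ProbTournament n) (e : MatchPair n) (c : Bool) :
    Ex T (fun O => if O e = c then 1 else 0) = wt T e c := by
  have h := Ex_prod T (fun e' x => if e' = e ∧ x ≠ c then 0 else 1)
  have h1 : ∀ O : Outcome n, (∏ e', if e' = e ∧ O e' ≠ c then (0:ℝ) else 1) =
      if O e = c then 1 else 0 := by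
    intro O
    rw [Finset.prod_eq_single e]
    · by_cases hc : O e = c <;> simp [hc]
    · intro e' _ hne
      simp [hne]
    · simp
  simp only [h1] at h
  rw [h, Finset.prod_eq_single e]
  · cases c <;> simp
  · intro e' _ hne
    simp only [hne, false_and, if_false, mul_one]
    exact wt_sum T e'
  · simp

/-- Indicator that `i` beats `j`. -/
noncomputable def ind {n : ℕ} (O : Outcome n) (i j : Fin n) : ℝ :=
  if Outcome.beats O i j = true then 1 else 0

theorem Ex_ind {n : ℕ} (T : ProbTournament n) (i j : Fin n) (h : i ≠ j) :
    Ex T (fun O => ind O i j) = T.p i j := by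
  rcases lt_or_gt_of_ne h with h | h
  · have := Ex_single T ⟨(i, j), h⟩ true
    simpa [ind, Outcome.beats, h, wt] using this
  · have := Ex_single T ⟨(j, i), h⟩ false
    simpa [ind, Outcome.beats, h, not_lt.2 h.le, wt] using this

theorem beats_congr {n : ℕ} (O O' : Outcome n) (i j : Fin n)
    (h : ∀ e : MatchPair n, (e.val = (i, j) ∨ e.val = (j, i)) → O e = O' e) :
    Outcome.beats O i j = Outcome.beats O' i j := by
  unfold Outcome.beats
  split_ifs with h1 h2
  · exact h _ (Or.inl rfl)
  · rw [h _ (Or.inr rfl)]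
  · rfl

theorem Ex_prod_ind {n : ℕ} (T : ProbTournament n) (s : Finset (Fin n)) (g : Fin n → Fin n)
    (hg : g ∈ Invo s) (t : Finset (Fin n)) : t ⊆ s → (∀ j ∈ t, g j ∉ t) →
    Ex T (fun O => ∏ j ∈ t, ind O j (g j)) = ∏ j ∈ t, T.p j (g j) := by
  have hg' := mem_Invo.1 hg
  induction t using Finset.induction_on with
  | empty => intro _ _; simpa using Ex_one T
  | insert i t hi ih =>
    intro hts ht
    have his : i ∈ s := hts (Finset.mem_insert_self _ _)
    have hne : g i ≠ i := (hg'.2 i).2 his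
    have ih' := ih (fun x hx => hts (Finset.mem_insert_of_mem hx))
      (fun j hj h => ht j (Finset.mem_insert_of_mem hj) (Finset.mem_insert_of_mem h))
    simp only [Finset.prod_insert hi]
    rw [Ex_indep T (fun e => e.val = (i, g i) ∨ e.val = (g i, i))
      (fun O => ind O i (g i)) (fun O => ∏ j ∈ t, ind O j (g j)), Ex_ind T i (g i) hne.symm, ih']
    · intro O O' h
      show ind O i (g i) = ind O' i (g i)
      unfold ind
      rw [beats_congr O O' i (g i) h]
    · intro O O' h
      refine Finset.prod_congr rfl (fun j hj => ?_)
      unfold ind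
      rw [beats_congr O O' j (g j)]
      intro e he
      apply h
      have hji : j ≠ i := fun hh => hi (hh ▸ hj)
      have hjg : j ≠ g i := fun hh =>
        ht i (Finset.mem_insert_self _ _) (Finset.mem_insert_of_mem (hh ▸ hj))
      rintro (h1 | h1) <;> rcases he with h2 | h2 <;> rw [h1] at h2 <;>
        simp only [Prod.mk.injEq] at h2
      · exact hji h2.1.symm
      · exact hjg h2.2.symm
      · exact hjg h2.1.symm
      · exact hji h2.2.symm

/-- `t` contains exactly one team of every match of `g`. -/
def trv {n : ℕ} (g : Fin n → Fin n) (s t : Finset (Fin n)) : Prop :=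
  t ⊆ s ∧ ∀ j ∈ s, (j ∈ t ↔ g j ∉ t)

/-- Probability that the survivor set of round `g` is `t`. -/
noncomputable def pr {n : ℕ} (T : ProbTournament n) (g : Fin n → Fin n)
    (s t : Finset (Fin n)) : ℝ :=
  if trv g s t then ∏ j ∈ t, T.p j (g j) else 0

theorem sv_eq_iff {n : ℕ} (O : Outcome n) (g : Fin n → Fin n) (s t : Finset (Fin n))
    (hg : g ∈ Invo s) :
    sv (Outcome.beats O) g s = t ↔ trv g s t ∧ ∀ j ∈ t, Outcome.beats O j (g j) = true := by
  have hg' := mem_Invo.1 hg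
  constructor
  · rintro rfl
    refine ⟨⟨Finset.filter_subset _ _, ?_⟩, ?_⟩
    · intro j hj
      have hb := beats_compl O j (g j) ((hg'.2 j).2 hj).symm
      simp only [sv, Finset.mem_filter, hj, true_and, Invo_mem hg hj, hg'.1, hb]
      cases Outcome.beats O (g j) j <;> simp
    · intro j hj
      exact (Finset.mem_filter.1 hj).2
  · rintro ⟨⟨h1, h2⟩, h3⟩
    ext j
    simp only [sv, Finset.mem_filter]
    constructor
    · rintro ⟨hj, hb⟩
      rw [h2 j hj]
      intro hgj
      have := h3 _ hgj
      rw [hg'.1, beats_compl O _ _ ((hg'.2 j).2 hj), hb] at this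
      simp at this
    · intro hj
      exact ⟨h1 hj, h3 j hj⟩

theorem Ex_sv_ind {n : ℕ} (T : ProbTournament n) (g : Fin n → Fin n) (s t : Finset (Fin n))
    (hg : g ∈ Invo s) :
    Ex T (fun O => if sv (Outcome.beats O) g s = t then 1 else 0) = pr T g s t := by
  unfold pr
  simp only [sv_eq_iff _ g s t hg]
  split_ifs with h
  · rw [← Ex_prod_ind T s g hg t h.1 (fun j hj => (h.2 j (h.1 hj)).1 hj)]
    congr 1
    funext O
    simp only [h, true_and, ind]
    rw [Finset.prod_boole]
    congr
  · simp [h, Ex]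

theorem Ex_sv {n : ℕ} (T : ProbTournament n) (g : Fin n → Fin n) (s : Finset (Fin n))
    (hg : g ∈ Invo s) (φ : Finset (Fin n) → ℝ) :
    Ex T (fun O => φ (sv (Outcome.beats O) g s)) = ∑ t ∈ s.powerset, pr T g s t * φ t := by
  have : ∀ O : Outcome n, φ (sv (Outcome.beats O) g s) =
      ∑ t ∈ s.powerset, φ t * (if sv (Outcome.beats O) g s = t then 1 else 0) := by
    intro O
    rw [Finset.sum_eq_single (sv (Outcome.beats O) g s)]
    · simp
    · intro b _ hb
      simp [hb.symm]
    · intro h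
      exact absurd (Finset.mem_powerset.2 (Finset.filter_subset _ _)) h
  simp only [this]
  rw [Ex_sum]
  refine Finset.sum_congr rfl (fun t _ => ?_)
  rw [Ex_mul_left, Ex_sv_ind T g s t hg, mul_comm]

/-- Probabilistic version of `winP`. -/
noncomputable def EW {n : ℕ} (T : ProbTournament n) : ℕ → Finset (Fin n) → Fin n → ℝ
  | 0, s, i => if i ∈ s then 1 else 0
  | k + 1, s, i => ((Invo s).card : ℝ)⁻¹ *
      ∑ g ∈ Invo s, ∑ t ∈ s.powerset, pr T g s t * EW T k t i

theorem winP_dep {n : ℕ} (k : ℕ) : ∀ (s : Finset (Fin n)) (O O' : Outcome n) (i : Fin n),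
    (∀ e : MatchPair n, e.val.1 ∈ s → e.val.2 ∈ s → O e = O' e) →
    winP k s (Outcome.beats O) i = winP k s (Outcome.beats O') i := by
  induction k with
  | zero => intro s O O' i _; rfl
  | succ k ih =>
    intro s O O' i h
    rw [winP, winP]
    congr 1
    refine Finset.sum_congr rfl (fun g hg => ?_)
    have hsv : sv (Outcome.beats O) g s = sv (Outcome.beats O') g s := by
      unfold sv
      refine Finset.filter_congr (fun j hj => ?_)
      rw [beats_congr O O' j (g j)]
      rintro e (he | he)
      · exact h e (by rw [he]; exact hj) (by rw [he]; exact Invo_mem hg hj)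
      · exact h e (by rw [he]; exact Invo_mem hg hj) (by rw [he]; exact hj)
    rw [hsv]
    apply ih
    intro e h1 h2
    exact h e (Finset.filter_subset _ _ h1) (Finset.filter_subset _ _ h2)

theorem Ex_winP {n : ℕ} (T : ProbTournament n) (k : ℕ) : ∀ (s : Finset (Fin n)) (i : Fin n),
    Ex T (fun O => winP k s (Outcome.beats O) i) = EW T k s i := by
  induction k with
  | zero =>
    intro s i
    simp only [winP, EW]
    have := Ex_mul_left T (if i ∈ s then 1 else 0) (fun _ => 1)
    simpa [Ex_one] using this
  | succ k ih =>
    intro s i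
    simp only [winP, EW]
    rw [Ex_mul_left, Ex_sum]
    congr 1
    refine Finset.sum_congr rfl (fun g hg => ?_)
    have hg' := mem_Invo.1 hg
    have : ∀ O : Outcome n, winP k (sv (Outcome.beats O) g s) (Outcome.beats O) i =
      ∑ t ∈ s.powerset, (if sv (Outcome.beats O) g s = t then 1 else 0) *
        winP k t (Outcome.beats O) i := by
      intro O
      rw [Finset.sum_eq_single (sv (Outcome.beats O) g s)]
      · simp
      · intro b _ hb
        simp [hb.symm]
      · intro h
        exact absurd (Finset.mem_powerset.2 (Finset.filter_subset _ _)) h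
    simp only [this]
    rw [Ex_sum]
    refine Finset.sum_congr rfl (fun t _ => ?_)
    by_cases htr : trv g s t
    · rw [Ex_indep T (fun e => ¬ (e.val.1 ∈ t ∧ e.val.2 ∈ t)), Ex_sv_ind T g s t hg, ih]
      · intro O O' h
        have hsv : sv (Outcome.beats O) g s = sv (Outcome.beats O') g s := by
          unfold sv
          refine Finset.filter_congr (fun j hj => ?_)
          rw [beats_congr O O' j (g j)]
          intro e he
          apply h
          have := htr.2 j hj
          rcases he with he | he <;> rw [he] <;> simp only <;> tauto
        simp only [hsv]
      · intro O O' h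
        apply winP_dep
        intro e h1 h2
        apply h
        simp only [not_not]
        exact ⟨h1, h2⟩
    · have h0 : ∀ O : Outcome n, ¬ (sv (Outcome.beats O) g s = t) := by
        intro O h
        exact htr ((sv_eq_iff O g s t hg).1 h).1
      simp [h0, pr, htr, Ex]

/-! ## Affine dependence on a single match probability -/

theorem prob_affine {n : ℕ} (T T1 T0 : ProbTournament n) (x y : Fin n) (hxy : x ≠ y) (l : ℝ)
    (h1 : ∀ i j, ¬ (i = x ∧ j = y) → ¬ (i = y ∧ j = x) → T1.p i j = T.p i j)
    (h0 : ∀ i j, ¬ (i = x ∧ j = y) → ¬ (i = y ∧ j = x) → T0.p i j = T.p i j)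
    (h : T.p x y = l * T1.p x y + (1 - l) * T0.p x y) (O : Outcome n) :
    T.prob O = l * T1.prob O + (1 - l) * T0.prob O := by
  have h' : T.p y x = l * T1.p y x + (1 - l) * T0.p y x := by
    have e := T.compl x y hxy
    have e1 := T1.compl x y hxy
    have e0 := T0.compl x y hxy
    have : T.p y x = 1 - T.p x y := by linarith
    rw [this, h]
    have : T1.p y x = 1 - T1.p x y := by linarith
    rw [this]
    have : T0.p y x = 1 - T0.p x y := by linarith
    rw [this]
    ring
  obtain ⟨e, he⟩ : ∃ e : MatchPair n, e.val = (x, y) ∨ e.val = (y, x) := by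
    rcases lt_or_gt_of_ne hxy with hl | hl
    · exact ⟨⟨(x, y), hl⟩, Or.inl rfl⟩
    · exact ⟨⟨(y, x), hl⟩, Or.inr rfl⟩
  have key : ∀ e' : MatchPair n, e' ≠ e → ∀ c, wt T1 e' c = wt T e' c ∧ wt T0 e' c = wt T e' c := by
    intro e' hne c
    have n1 : ¬ (e'.val.1 = x ∧ e'.val.2 = y) := by
      rintro ⟨ha, hb⟩
      rcases he with he | he
      · exact hne (Subtype.ext (by rw [he]; exact Prod.ext ha hb))
      · have l1 := e'.2
        have l2 := e.2
        rw [he] at l2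
        rw [ha, hb] at l1
        exact absurd l1 (not_lt.2 (le_of_lt l2))
    have n2 : ¬ (e'.val.1 = y ∧ e'.val.2 = x) := by
      rintro ⟨ha, hb⟩
      rcases he with he | he
      · have l1 := e'.2
        have l2 := e.2
        rw [he] at l2
        rw [ha, hb] at l1
        exact absurd l1 (not_lt.2 (le_of_lt l2))
      · exact hne (Subtype.ext (by rw [he]; exact Prod.ext ha hb))
    have n1' : ¬ (e'.val.2 = x ∧ e'.val.1 = y) := fun hh => n2 ⟨hh.2, hh.1⟩
    have n2' : ¬ (e'.val.2 = y ∧ e'.val.1 = x) := fun hh => n1 ⟨hh.2, hh.1⟩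
    unfold wt
    rw [h1 _ _ n1 n2, h0 _ _ n1 n2, h1 _ _ n1' n2', h0 _ _ n1' n2']
    exact ⟨rfl, rfl⟩
  simp only [prob_eq]
  rw [← Finset.mul_prod_erase _ _ (Finset.mem_univ e),
    ← Finset.mul_prod_erase _ (fun e => wt T1 e (O e)) (Finset.mem_univ e),
    ← Finset.mul_prod_erase _ (fun e => wt T0 e (O e)) (Finset.mem_univ e)]
  rw [Finset.prod_congr rfl (g := fun e => wt T e (O e))
      (fun e' he' => (key e' (Finset.ne_of_mem_erase he') (O e')).1),
    Finset.prod_congr rfl (f := fun e => wt T0 e (O e)) (g := fun e => wt T e (O e))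
      (fun e' he' => (key e' (Finset.ne_of_mem_erase he') (O e')).2)]
  have hw : wt T e (O e) = l * wt T1 e (O e) + (1 - l) * wt T0 e (O e) := by
    unfold wt
    rcases he with he | he <;> rw [he] <;> split_ifs <;> assumption
  rw [hw]
  ring

theorem EW_affine {n : ℕ} (T T1 T0 : ProbTournament n) (x y : Fin n) (hxy : x ≠ y) (l : ℝ)
    (h1 : ∀ i j, ¬ (i = x ∧ j = y) → ¬ (i = y ∧ j = x) → T1.p i j = T.p i j)
    (h0 : ∀ i j, ¬ (i = x ∧ j = y) → ¬ (i = y ∧ j = x) → T0.p i j = T.p i j)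
    (h : T.p x y = l * T1.p x y + (1 - l) * T0.p x y) (k : ℕ) (s : Finset (Fin n)) (i : Fin n) :
    EW T k s i = l * EW T1 k s i + (1 - l) * EW T0 k s i := by
  rw [← Ex_winP, ← Ex_winP, ← Ex_winP]
  unfold Ex
  rw [Finset.mul_sum, Finset.mul_sum, ← Finset.sum_add_distrib]
  refine Finset.sum_congr rfl (fun O _ => ?_)
  rw [prob_affine T T1 T0 x y hxy l h1 h0 h O]
  ring

/-- Replace the probability of `x` beating `y` by `r`. -/
noncomputable def setP {n : ℕ} (T : ProbTournament n) (x y : Fin n) (hxy : x ≠ y) (r : ℝ)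
    (hr : r ∈ Set.Icc (0:ℝ) 1) : ProbTournament n where
  p i j := if i = x ∧ j = y then r else if i = y ∧ j = x then 1 - r else T.p i j
  mem_Icc i j := by
    split_ifs
    · exact hr
    · exact ⟨by linarith [hr.2], by linarith [hr.1]⟩
    · exact T.mem_Icc i j
  compl i j hij := by
    by_cases h1 : i = x ∧ j = y
    · obtain ⟨rfl, rfl⟩ := h1
      simp [hij]
    · by_cases h2 : i = y ∧ j = x
      · obtain ⟨rfl, rfl⟩ := h2
        simp [hij]
      · have h1' : ¬ (j = y ∧ i = x) := fun h => h1 ⟨h.2, h.1⟩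
        have h2' : ¬ (j = x ∧ i = y) := fun h => h2 ⟨h.2, h.1⟩
        simp only [h1, h2, h1', h2', if_false]
        exact T.compl i j hij

theorem setP_self {n : ℕ} (T : ProbTournament n) (x y : Fin n) (hxy : x ≠ y) (r : ℝ)
    (hr : r ∈ Set.Icc (0:ℝ) 1) : (setP T x y hxy r hr).p x y = r := by
  simp [setP]

theorem setP_other {n : ℕ} (T : ProbTournament n) (x y : Fin n) (hxy : x ≠ y) (r : ℝ)
    (hr : r ∈ Set.Icc (0:ℝ) 1) (i j : Fin n) (h1 : ¬ (i = x ∧ j = y)) (h2 : ¬ (i = y ∧ j = x)) :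
    (setP T x y hxy r hr).p i j = T.p i j := by
  simp [setP, h1, h2]

/-! ## Basic facts about `EW` -/

theorem pr_nonneg {n : ℕ} (T : ProbTournament n) (g : Fin n → Fin n) (s t : Finset (Fin n)) :
    0 ≤ pr T g s t := by
  unfold pr
  split_ifs
  · exact Finset.prod_nonneg (fun j _ => (T.mem_Icc _ _).1)
  · exact le_refl _

theorem pr_sum {n : ℕ} (T : ProbTournament n) (g : Fin n → Fin n) (s : Finset (Fin n))
    (hg : g ∈ Invo s) : ∑ t ∈ s.powerset, pr T g s t = 1 := by
  have := Ex_sv T g s hg (fun _ => 1)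
  rw [Ex_one] at this
  simpa using this.symm

theorem pr_congr {n : ℕ} (T T2 : ProbTournament n) (g : Fin n → Fin n) (s t : Finset (Fin n))
    (h : trv g s t → ∀ j ∈ t, T.p j (g j) = T2.p j (g j)) : pr T g s t = pr T2 g s t := by
  unfold pr
  split_ifs with ht
  · exact Finset.prod_congr rfl (h ht)
  · rfl

theorem pr_eq_zero {n : ℕ} (T : ProbTournament n) (g : Fin n → Fin n) (s t : Finset (Fin n))
    (i : Fin n) (hi : i ∈ t) (h : T.p i (g i) = 0) : pr T g s t = 0 := by
  unfold pr
  split_ifs with ht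
  · exact Finset.prod_eq_zero hi h
  · rfl

theorem EW_notMem {n : ℕ} (T : ProbTournament n) (k : ℕ) (s : Finset (Fin n)) (i : Fin n)
    (hi : i ∉ s) : EW T k s i = 0 := by
  rw [← Ex_winP]
  unfold Ex
  exact Finset.sum_eq_zero (fun O _ => by
    simp only [winP_zero_of_notMem k s _ i hi, mul_zero])

theorem EW_nonneg {n : ℕ} (T : ProbTournament n) (k : ℕ) : ∀ (s : Finset (Fin n)) (i : Fin n),
    0 ≤ EW T k s i := by
  induction k with
  | zero => intro s i; rw [EW]; split_ifs <;> norm_num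
  | succ k ih =>
    intro s i
    rw [EW]
    exact mul_nonneg (inv_nonneg.2 (Nat.cast_nonneg _)) (Finset.sum_nonneg (fun g _ =>
      Finset.sum_nonneg (fun t _ => mul_nonneg (pr_nonneg _ _ _ _) (ih _ _))))

theorem EW_local {n : ℕ} (T T2 : ProbTournament n) (k : ℕ) : ∀ (s : Finset (Fin n)) (i : Fin n),
    (∀ a ∈ s, ∀ b ∈ s, a ≠ b → T.p a b = T2.p a b) → EW T k s i = EW T2 k s i := by
  induction k with
  | zero => intro s i _; rfl
  | succ k ih =>
    intro s i h
    rw [EW, EW]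
    congr 1
    refine Finset.sum_congr rfl (fun g hg => Finset.sum_congr rfl (fun t ht => ?_))
    have hts := Finset.mem_powerset.1 ht
    rw [ih t i (fun a ha b hb hab => h a (hts ha) b (hts hb) hab)]
    congr 1
    apply pr_congr
    intro _ j hj
    exact h j (hts hj) _ (Invo_mem hg (hts hj)) (((mem_Invo.1 hg).2 j).2 (hts hj)).symm

theorem Invo_sum_map {n N : ℕ} (f : Fin n ↪ Fin N) (s : Finset (Fin n))
    (F : (Fin N → Fin N) → ℝ) :
    ∑ G ∈ Invo (s.map f), F G = ∑ g ∈ Invo s, F (extG f g) := by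
  symm
  refine Finset.sum_bij (fun g _ => extG f g) (fun g hg => extG_mem f s g hg)
    (fun g _ g' _ h => extG_inj f h) (fun G hG => ?_) (fun g _ => rfl)
  obtain ⟨g, hg, he⟩ := extG_surj f s G hG
  exact ⟨g, hg, he⟩

theorem powerset_sum_map {n N : ℕ} (f : Fin n ↪ Fin N) (s : Finset (Fin n))
    (F : Finset (Fin N) → ℝ) :
    ∑ t ∈ (s.map f).powerset, F t = ∑ t ∈ s.powerset, F (t.map f) := by
  symm
  refine Finset.sum_bij (fun t _ => t.map f) ?_ ?_ ?_ (fun g _ => rfl)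
  · intro t ht
    exact Finset.mem_powerset.2 (Finset.map_subset_map.2 (Finset.mem_powerset.1 ht))
  · intro t _ t' _ h
    exact Finset.map_injective f h
  · intro t ht
    obtain ⟨t', h1, h2⟩ := Finset.subset_map_iff.1 (Finset.mem_powerset.1 ht)
    exact ⟨t', Finset.mem_powerset.2 h1, h2.symm⟩

/-- Relabeled tournament. -/
noncomputable def permT {n : ℕ} (T : ProbTournament n) (σ : Equiv.Perm (Fin n)) :
    ProbTournament n where
  p i j := T.p (σ i) (σ j)
  mem_Icc _ _ := T.mem_Icc _ _
  compl _ _ h := T.compl _ _ (fun e => h (σ.injective e))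

theorem pr_perm {n : ℕ} (T : ProbTournament n) (σ : Equiv.Perm (Fin n)) (g : Fin n → Fin n)
    (s t : Finset (Fin n)) :
    pr T (extG σ.toEmbedding g) (s.map σ.toEmbedding) (t.map σ.toEmbedding) =
      pr (permT T σ) g s t := by
  have hap : ∀ i, extG σ.toEmbedding g (σ i) = σ (g i) := fun i => extG_apply σ.toEmbedding g i
  have htr : trv (extG σ.toEmbedding g) (s.map σ.toEmbedding) (t.map σ.toEmbedding) ↔
      trv g s t := by
    unfold trv
    rw [Finset.map_subset_map]
    refine and_congr_right (fun _ => ?_)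
    constructor
    · intro h j hj
      have := h (σ j) (Finset.mem_map_of_mem σ.toEmbedding hj)
      rw [hap] at this
      simpa using this
    · intro h j hj
      obtain ⟨i, hi, rfl⟩ := Finset.mem_map.1 hj
      have := h i hi
      simp only [Equiv.coe_toEmbedding]
      rw [hap]
      simpa using this
  unfold pr
  simp only [htr]
  split_ifs
  · rw [Finset.prod_map]
    refine Finset.prod_congr rfl (fun j _ => ?_)
    simp only [Equiv.coe_toEmbedding, hap]
    rfl
  · rfl

theorem EW_perm {n : ℕ} (T : ProbTournament n) (σ : Equiv.Perm (Fin n)) (k : ℕ) :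
    ∀ (s : Finset (Fin n)) (i : Fin n),
    EW T k (s.map σ.toEmbedding) (σ i) = EW (permT T σ) k s i := by
  induction k with
  | zero => intro s i; simp [EW]
  | succ k ih =>
    intro s i
    rw [EW, EW, Invo_sum_map]
    congr 1
    · have h1 := Invo_sum_map σ.toEmbedding s (fun _ => 1)
      simp only [Finset.sum_const, nsmul_eq_mul, mul_one] at h1
      rw [h1]
    · refine Finset.sum_congr rfl (fun g hg => ?_)
      rw [powerset_sum_map]
      refine Finset.sum_congr rfl (fun t ht => ?_)
      rw [pr_perm, ih]

/-- `T` modified so that `u` always wins. -/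
noncomputable def winT {n : ℕ} (T : ProbTournament n) (u : Fin n) : ProbTournament n where
  p i j := if i = u then 1 else if j = u then 0 else T.p i j
  mem_Icc i j := by
    split_ifs
    · norm_num
    · norm_num
    · exact T.mem_Icc i j
  compl i j h := by
    by_cases hi : i = u <;> by_cases hj : j = u
    · exact absurd (hi.trans hj.symm) h
    · simp [hi, hj]
    · simp [hi, hj]
    · simp [hi, hj, T.compl i j h]

theorem pr_winT {n : ℕ} (T T2 : ProbTournament n) (g : Fin n → Fin n) (s t : Finset (Fin n))
    (u : Fin n) (hg : g ∈ Invo s) (hu : u ∈ t)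
    (h : ∀ a ∈ s, ∀ b ∈ s, a ≠ b → a ≠ u → b ≠ u → T.p a b = T2.p a b) :
    pr T2 g s t = T2.p u (g u) * pr (winT T u) g s t := by
  unfold pr
  split_ifs with ht
  · rw [← Finset.mul_prod_erase t _ hu, ← Finset.mul_prod_erase t (fun j => (winT T u).p j (g j)) hu]
    have h1 : (winT T u).p u (g u) = 1 := by simp [winT]
    rw [h1, one_mul]
    congr 1
    refine Finset.prod_congr rfl (fun j hj => ?_)
    have hju := Finset.ne_of_mem_erase hj
    have hjt := Finset.mem_of_mem_erase hj
    have hjs := ht.1 hjt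
    have hgj : g j ≠ u := fun e => (ht.2 j hjs).1 hjt (e ▸ hu)
    simp only [winT, hju, hgj, if_false]
    exact (h j hjs _ (Invo_mem hg hjs) (((mem_Invo.1 hg).2 j).2 hjs).symm hju hgj).symm
  · simp

theorem FA {n : ℕ} (T T2 : ProbTournament n) (u : Fin n) (k : ℕ) : ∀ (s : Finset (Fin n)),
    (∀ a ∈ s, ∀ b ∈ s, a ≠ b → a ≠ u → b ≠ u → T.p a b = T2.p a b) →
    (∀ x ∈ s, x ≠ u → T.p u x ≤ T2.p u x) → EW T k s u ≤ EW T2 k s u := by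
  induction k with
  | zero => intro s _ _; exact le_refl _
  | succ k ih =>
    intro s h hle
    rw [EW, EW]
    refine mul_le_mul_of_nonneg_left ?_ (inv_nonneg.2 (Nat.cast_nonneg _))
    refine Finset.sum_le_sum (fun g hg => Finset.sum_le_sum (fun t ht => ?_))
    have hts := Finset.mem_powerset.1 ht
    by_cases hu : u ∈ t
    · have ih' := ih t (fun a ha b hb => h a (hts ha) b (hts hb)) (fun x hx => hle x (hts hx))
      rw [pr_winT T T g s t u hg hu (fun _ _ _ _ _ _ _ => rfl), pr_winT T T2 g s t u hg hu h]
      have h1 := hle (g u) (Invo_mem hg (hts hu)) (((mem_Invo.1 hg).2 u).2 (hts hu))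
      refine mul_le_mul ?_ ih' (EW_nonneg _ _ _ _)
        (mul_nonneg (T2.mem_Icc _ _).1 (pr_nonneg _ _ _ _))
      exact mul_le_mul_of_nonneg_right h1 (pr_nonneg _ _ _ _)
    · rw [EW_notMem _ _ _ _ hu, EW_notMem _ _ _ _ hu, mul_zero, mul_zero]

theorem avg_le {ι : Type*} (A : Finset ι) (F : ι → ℝ) (c : ℝ) (hc : 0 ≤ c)
    (h : ∑ g ∈ A, F g ≤ c * A.card) : (A.card : ℝ)⁻¹ * ∑ g ∈ A, F g ≤ c := by
  rcases Nat.eq_zero_or_pos A.card with h0 | h0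
  · rw [h0]; simpa using hc
  · have : (0:ℝ) < A.card := by exact_mod_cast h0
    rw [inv_mul_le_iff₀ this]
    linarith

theorem FB {n : ℕ} (ε : ℝ) (hε : 0 ≤ ε) (hε2 : ε ≤ 1/2) (T T2 : ProbTournament n) (u : Fin n)
    (k : ℕ) : ∀ (s : Finset (Fin n)) (P Q : ℝ), 0 ≤ P → 0 ≤ Q →
    ((P = Q ∧ P ≤ 1) ∨ (P + Q ≤ 1 ∧ |P - Q| ≤ 2 * ε)) →
    (∀ a ∈ s, ∀ b ∈ s, a ≠ b → a ≠ u → b ≠ u → T.p a b = T2.p a b) →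
    (∀ x ∈ s, x ≠ u → (T.p u x = T2.p u x ∨ (T.p u x = 1/2 + ε ∧ T2.p u x = 1/2 - ε) ∨
      (T.p u x = 1/2 - ε ∧ T2.p u x = 1/2 + ε))) →
    P * EW T k s u - Q * EW T2 k s u ≤ 2 * ε := by
  induction k with
  | zero =>
    intro s P Q hP hQ hPQ _ _
    simp only [EW]
    split_ifs
    · rcases hPQ with ⟨h1, h2⟩ | ⟨h1, h2⟩
      · rw [h1]; linarith
      · have := (abs_le.1 h2).2; linarith
    · linarith
  | succ k ih =>
    intro s P Q hP hQ hPQ h hty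
    simp only [EW]
    have : P * (((Invo s).card : ℝ)⁻¹ * ∑ g ∈ Invo s, ∑ t ∈ s.powerset, pr T g s t * EW T k t u) -
      Q * (((Invo s).card : ℝ)⁻¹ * ∑ g ∈ Invo s, ∑ t ∈ s.powerset, pr T2 g s t * EW T2 k t u) =
      ((Invo s).card : ℝ)⁻¹ * ∑ g ∈ Invo s, (∑ t ∈ s.powerset,
        (P * (pr T g s t * EW T k t u) - Q * (pr T2 g s t * EW T2 k t u))) := by
      simp only [Finset.sum_sub_distrib, ← Finset.mul_sum]
      ring
    rw [this]
    apply avg_le _ _ _ (by linarith)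
    rw [mul_comm, ← nsmul_eq_mul]
    apply Finset.sum_le_card_nsmul
    intro g hg
    have h1 : ∑ t ∈ s.powerset, pr (winT T u) g s t * (2 * ε) = 2 * ε := by
      rw [← Finset.sum_mul, pr_sum _ _ _ hg, one_mul]
    rw [← h1]
    refine Finset.sum_le_sum (fun t ht => ?_)
    have hts := Finset.mem_powerset.1 ht
    by_cases hu : u ∈ t
    · rw [pr_winT T T g s t u hg hu (fun _ _ _ _ _ _ _ => rfl), pr_winT T T2 g s t u hg hu h]
      have e1 : P * (T.p u (g u) * pr (winT T u) g s t * EW T k t u) -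
        Q * (T2.p u (g u) * pr (winT T u) g s t * EW T2 k t u) = pr (winT T u) g s t *
          ((P * T.p u (g u)) * EW T k t u - (Q * T2.p u (g u)) * EW T2 k t u) := by ring
      rw [e1]
      refine mul_le_mul_of_nonneg_left ?_ (pr_nonneg _ _ _ _)
      have hp := T.mem_Icc u (g u)
      have hp2 := T2.mem_Icc u (g u)
      apply ih t _ _ (mul_nonneg hP hp.1) (mul_nonneg hQ hp2.1) _
        (fun a ha b hb => h a (hts ha) b (hts hb)) (fun x hx => hty x (hts hx))
      rcases hty (g u) (Invo_mem hg (hts hu)) (((mem_Invo.1 hg).2 u).2 (hts hu)) with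
        he | ⟨he1, he2⟩ | ⟨he1, he2⟩
      · rw [← he]
        rcases hPQ with ⟨h1, h2⟩ | ⟨h1, h2⟩
        · left
          rw [h1]
          refine ⟨rfl, ?_⟩
          have := mul_le_mul (h1 ▸ h2) hp.2 hp.1 zero_le_one
          linarith
        · right
          constructor
          · nlinarith [hp.1, hp.2]
          · rw [← sub_mul, abs_mul, abs_of_nonneg hp.1]
            nlinarith [hp.1, hp.2, abs_nonneg (P - Q)]
      · right
        rw [he1, he2]
        rcases hPQ with ⟨h1, h2⟩ | ⟨h1, h2⟩
        · subst h1
          refine ⟨by linarith, ?_⟩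
          rw [abs_le]; constructor <;> nlinarith
        · have := abs_le.1 h2
          refine ⟨by nlinarith, ?_⟩
          rw [abs_le]; constructor <;> nlinarith
      · right
        rw [he1, he2]
        rcases hPQ with ⟨h1, h2⟩ | ⟨h1, h2⟩
        · subst h1
          refine ⟨by linarith, ?_⟩
          rw [abs_le]; constructor <;> nlinarith
        · have := abs_le.1 h2
          refine ⟨by nlinarith, ?_⟩
          rw [abs_le]; constructor <;> nlinarith
    · rw [EW_notMem _ _ _ _ hu, EW_notMem _ _ _ _ hu]
      have := pr_nonneg (winT T u) g s t
      have : 0 ≤ pr (winT T u) g s t * (2 * ε) := mul_nonneg this (by linarith)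
      linarith


/-! ## The main inductive claim -/

/-- The normalized situation: `u` beats `v` in `T1`, loses in `T0`. -/
structure Setup {n : ℕ} (ε : ℝ) (T1 T0 : ProbTournament n) (u v : Fin n) : Prop where
  eps0 : 0 ≤ ε
  eps1 : ε ≤ 1/2
  huv : u ≠ v
  h1 : T1.p u v = 1
  h0 : T0.p u v = 0
  agree : ∀ i j, ¬ (i = u ∧ j = v) → ¬ (i = v ∧ j = u) → T1.p i j = T0.p i j
  typ : ∀ x, x ≠ u → x ≠ v → (T1.p u x = T1.p v x ∨
    (T1.p u x = 1/2 + ε ∧ T1.p v x = 1/2 - ε) ∨ (T1.p u x = 1/2 - ε ∧ T1.p v x = 1/2 + ε))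

/-- Probability that `u` or `v` wins. -/
noncomputable def SS {n : ℕ} (T : ProbTournament n) (u v : Fin n) (k : ℕ) (s : Finset (Fin n)) : ℝ :=
  EW T k s u + EW T k s v

/-- Teams against which `u` is stronger than `v`. -/
def isB {n : ℕ} (T : ProbTournament n) (u v x : Fin n) : Prop :=
  x ≠ u ∧ x ≠ v ∧ T.p v x < T.p u x

/-- Contribution of one matching. -/
noncomputable def DD {n : ℕ} (T1 T0 : ProbTournament n) (u v : Fin n) (k : ℕ)
    (s : Finset (Fin n)) (g : Fin n → Fin n) : ℝ :=
  ∑ t ∈ s.powerset, (pr T1 g s t * SS T1 u v k t - pr T0 g s t * SS T0 u v k t)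

theorem diff_step {n : ℕ} (T1 T0 : ProbTournament n) (u v : Fin n) (k : ℕ)
    (s : Finset (Fin n)) : SS T1 u v (k+1) s - SS T0 u v (k+1) s =
      ((Invo s).card : ℝ)⁻¹ * ∑ g ∈ Invo s, DD T1 T0 u v k s g := by
  unfold SS DD SS
  simp only [EW, mul_add, Finset.sum_sub_distrib, Finset.sum_add_distrib]
  ring

theorem swap_map {n : ℕ} (u v : Fin n) (s : Finset (Fin n)) (hu : u ∈ s) (hv : v ∈ s) :
    s.map (Equiv.swap u v).toEmbedding = s := by
  apply Finset.eq_of_subset_of_card_le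
  · intro x hx
    obtain ⟨y, hy, rfl⟩ := Finset.mem_map.1 hx
    simp only [Equiv.coe_toEmbedding]
    rw [Equiv.swap_apply_def]
    split_ifs <;> assumption
  · rw [Finset.card_map]

theorem extG_swap {n : ℕ} (u v : Fin n) (s : Finset (Fin n)) (g : Fin n → Fin n)
    (hg : g ∈ Invo s) (h : g u = v) : extG (Equiv.swap u v).toEmbedding g = g := by
  have hg' := mem_Invo.1 hg
  have h2 : g v = u := by rw [← h, hg'.1]
  funext x
  obtain ⟨y, rfl⟩ := (Equiv.swap u v).surjective x
  have := extG_apply (Equiv.swap u v).toEmbedding g y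
  simp only [Equiv.coe_toEmbedding] at this
  rw [this]
  by_cases hu : y = u
  · subst hu; simp [h, h2]
  · by_cases hv : y = v
    · subst hv; simp [h, h2]
    · rw [Equiv.swap_apply_of_ne_of_ne hu hv, Equiv.swap_apply_of_ne_of_ne]
      · intro e; apply hv; rw [← h, ← e, hg'.1]
      · intro e; apply hu; rw [← h2, ← e, hg'.1]

theorem SS_swap {n : ℕ} (T : ProbTournament n) (u v : Fin n) (k : ℕ) (t : Finset (Fin n)) :
    SS T u v k (t.map (Equiv.swap u v).toEmbedding) = SS (permT T (Equiv.swap u v)) u v k t := by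
  unfold SS
  rw [← EW_perm, ← EW_perm, Equiv.swap_apply_left, Equiv.swap_apply_right, add_comm]

theorem DD_match_eq {n : ℕ} {ε : ℝ} {T1 T0 : ProbTournament n} {u v : Fin n}
    (H : Setup ε T1 T0 u v) (k : ℕ) (s : Finset (Fin n)) (hu : u ∈ s) (hv : v ∈ s)
    (g : Fin n → Fin n) (hg : g ∈ Invo s) (h : g u = v) :
    DD T1 T0 u v k s g = ∑ t ∈ s.powerset, pr T1 g s t *
      (SS T1 u v k t - SS (permT T0 (Equiv.swap u v)) u v k t) := by
  have hg' := mem_Invo.1 hg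
  have h2 : g v = u := by rw [← h, hg'.1]
  unfold DD
  rw [Finset.sum_sub_distrib]
  have e1 := powerset_sum_map (Equiv.swap u v).toEmbedding s (fun t => pr T0 g s t * SS T0 u v k t)
  rw [swap_map u v s hu hv] at e1
  rw [e1, ← Finset.sum_sub_distrib]
  refine Finset.sum_congr rfl (fun t ht => ?_)
  have e2 := pr_perm T0 (Equiv.swap u v) g s t
  rw [extG_swap u v s g hg h, swap_map u v s hu hv] at e2
  rw [e2, SS_swap, mul_sub]
  congr 2
  have c1 := T1.compl u v H.huv
  have c0 := T0.compl u v H.huv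
  rw [H.h1] at c1
  rw [H.h0] at c0
  apply pr_congr
  intro _ j hj
  simp only [permT]
  by_cases hju : j = u
  · subst hju
    rw [h, Equiv.swap_apply_left, Equiv.swap_apply_right, H.h1]
    linarith
  · by_cases hjv : j = v
    · subst hjv
      rw [h2, Equiv.swap_apply_left, Equiv.swap_apply_right, H.h0]
      linarith
    · have n1 : g j ≠ u := by
        intro e; apply hjv; rw [← h, ← e, hg'.1]
      have n2 : g j ≠ v := by
        intro e; apply hju; rw [← h2, ← e, hg'.1]
      rw [Equiv.swap_apply_of_ne_of_ne hju hjv, Equiv.swap_apply_of_ne_of_ne n1 n2]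
      exact (H.agree _ _ (fun e => hju e.1) (fun e => hjv e.1)).symm

theorem DD_match {n : ℕ} {ε : ℝ} {T1 T0 : ProbTournament n} {u v : Fin n}
    (H : Setup ε T1 T0 u v) (k : ℕ) (s : Finset (Fin n)) (hu : u ∈ s) (hv : v ∈ s)
    (g : Fin n → Fin n) (hg : g ∈ Invo s) (h : g u = v) :
    DD T1 T0 u v k s g ≤ 2 * ε ∧ ((∀ x ∈ s, ¬ isB T1 u v x) → DD T1 T0 u v k s g ≤ 0) := by
  have hg' := mem_Invo.1 hg
  have h2 : g v = u := by rw [← h, hg'.1]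
  have he0 := H.eps0
  have c1 := T1.compl u v H.huv
  rw [H.h1] at c1
  rw [DD_match_eq H k s hu hv g hg h]
  -- agreement on sets without `v`
  have hag : ∀ t : Finset (Fin n), v ∉ t → ∀ a ∈ t, ∀ b ∈ t, a ≠ b → a ≠ u → b ≠ u →
      T1.p a b = (permT T0 (Equiv.swap u v)).p a b := by
    intro t hvt a ha b hb _ hau hbu
    have hav : a ≠ v := fun e => hvt (e ▸ ha)
    have hbv : b ≠ v := fun e => hvt (e ▸ hb)
    simp only [permT]
    rw [Equiv.swap_apply_of_ne_of_ne hau hav, Equiv.swap_apply_of_ne_of_ne hbu hbv]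
    exact H.agree _ _ (fun e => hau e.1) (fun e => hav e.1)
  have hval : ∀ x, x ≠ u → x ≠ v → (permT T0 (Equiv.swap u v)).p u x = T1.p v x := by
    intro x hxu hxv
    simp only [permT]
    rw [Equiv.swap_apply_of_ne_of_ne hxu hxv, Equiv.swap_apply_left]
    exact (H.agree _ _ (fun e => H.huv e.1.symm) (fun e => hxu e.2)).symm
  constructor
  · have e : ∑ t ∈ s.powerset, pr T1 g s t * (2 * ε) = 2 * ε := by
      rw [← Finset.sum_mul, pr_sum _ _ _ hg, one_mul]
    rw [← e]
    refine Finset.sum_le_sum (fun t ht => ?_)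
    by_cases hvt : v ∈ t
    · rw [pr_eq_zero T1 g s t v hvt (by rw [h2]; linarith)]
      simp
    · refine mul_le_mul_of_nonneg_left ?_ (pr_nonneg _ _ _ _)
      unfold SS
      rw [EW_notMem _ _ _ _ hvt, EW_notMem _ _ _ _ hvt]
      have := FB ε H.eps0 H.eps1 T1 (permT T0 (Equiv.swap u v)) u k t 1 1 zero_le_one zero_le_one
        (Or.inl ⟨rfl, le_refl _⟩) (hag t hvt) (fun x hx hxu => by
          have hxv : x ≠ v := fun e => hvt (e ▸ hx)
          rw [hval x hxu hxv]
          exact H.typ x hxu hxv)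
      linarith
  · intro hB
    apply Finset.sum_nonpos
    intro t ht
    have hts := Finset.mem_powerset.1 ht
    by_cases hvt : v ∈ t
    · rw [pr_eq_zero T1 g s t v hvt (by rw [h2]; linarith)]
      simp
    · refine mul_nonpos_of_nonneg_of_nonpos (pr_nonneg _ _ _ _) ?_
      unfold SS
      rw [EW_notMem _ _ _ _ hvt, EW_notMem _ _ _ _ hvt]
      have := FA T1 (permT T0 (Equiv.swap u v)) u k t (hag t hvt) (fun x hx hxu => by
          have hxv : x ≠ v := fun e => hvt (e ▸ hx)
          rw [hval x hxu hxv]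
          by_contra hlt
          exact hB x (hts hx) ⟨hxu, hxv, not_le.1 hlt⟩)
      linarith

/-- Probability that `u`, `v` and some team of `B` survive the round. -/
noncomputable def GG {n : ℕ} (T : ProbTournament n) (u v : Fin n)
    (s : Finset (Fin n)) (g : Fin n → Fin n) : ℝ :=
  ∑ t ∈ s.powerset, pr T g s t * (if u ∈ t ∧ v ∈ t ∧ ∃ x ∈ t, isB T u v x then 1 else 0)

theorem DD_nomatch {n : ℕ} {ε : ℝ} {T1 T0 : ProbTournament n} {u v : Fin n}
    (H : Setup ε T1 T0 u v) (k : ℕ) (s : Finset (Fin n))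
    (ih : ∀ t : Finset (Fin n), u ∈ t → v ∈ t →
      (SS T1 u v k t - SS T0 u v k t ≤ 2 * ε / 3 ∧
      ((∀ x ∈ t, ¬ isB T1 u v x) → SS T1 u v k t - SS T0 u v k t ≤ 0)))
    (g : Fin n → Fin n) (hg : g ∈ Invo s) (h : g u ≠ v) :
    DD T1 T0 u v k s g ≤ 2 * ε / 3 * GG T1 u v s g := by
  have hg' := mem_Invo.1 hg
  have he0 := H.eps0
  have h2 : g v ≠ u := by intro e; apply h; rw [← e, hg'.1]
  unfold DD GG
  rw [Finset.mul_sum]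
  refine Finset.sum_le_sum (fun t ht => ?_)
  have e1 : pr T0 g s t = pr T1 g s t := by
    apply pr_congr
    intro _ j hj
    refine (H.agree _ _ ?_ ?_).symm
    · rintro ⟨rfl, e⟩; exact h e
    · rintro ⟨rfl, e⟩; exact h2 e
  rw [e1, ← mul_sub]
  have key : SS T1 u v k t - SS T0 u v k t ≤
      2 * ε / 3 * (if u ∈ t ∧ v ∈ t ∧ ∃ x ∈ t, isB T1 u v x then 1 else 0) := by
    by_cases hut : u ∈ t ∧ v ∈ t
    · obtain ⟨i1, i2⟩ := ih t hut.1 hut.2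
      split_ifs with hc
      · linarith
      · have := i2 (fun x hx hb => hc ⟨hut.1, hut.2, x, hx, hb⟩)
        linarith
    · have : SS T1 u v k t = SS T0 u v k t := by
        have hl : ∀ a ∈ t, ∀ b ∈ t, a ≠ b → T1.p a b = T0.p a b := by
          intro a ha b hb _
          apply H.agree
          · rintro ⟨rfl, rfl⟩; exact hut ⟨ha, hb⟩
          · rintro ⟨rfl, rfl⟩; exact hut ⟨hb, ha⟩
        unfold SS
        rw [EW_local T1 T0 k t u hl, EW_local T1 T0 k t v hl]
      rw [this, sub_self]
      split_ifs <;> linarith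
  have := mul_le_mul_of_nonneg_left key (pr_nonneg T1 g s t)
  linarith

theorem marg1 {n : ℕ} (T : ProbTournament n) (s : Finset (Fin n)) (g : Fin n → Fin n)
    (hg : g ∈ Invo s) (u : Fin n) (hu : u ∈ s) :
    ∑ t ∈ s.powerset, pr T g s t * (if u ∈ t then 1 else 0) = T.p u (g u) := by
  rw [← Ex_sv T g s hg (fun t => if u ∈ t then 1 else 0),
    ← Ex_ind T u (g u) (((mem_Invo.1 hg).2 u).2 hu).symm]
  congr 1
  funext O
  simp [sv, ind, hu]

theorem marg2 {n : ℕ} (T : ProbTournament n) (s : Finset (Fin n)) (g : Fin n → Fin n)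
    (hg : g ∈ Invo s) (u v : Fin n) (hu : u ∈ s) (hv : v ∈ s) (huv : u ≠ v) (h : g u ≠ v) :
    ∑ t ∈ s.powerset, pr T g s t * (if u ∈ t ∧ v ∈ t then 1 else 0) =
      T.p u (g u) * T.p v (g v) := by
  have hg' := mem_Invo.1 hg
  have h2 : g v ≠ u := by intro e; apply h; rw [← e, hg'.1]
  have e := Ex_prod_ind T s g hg {u, v} (by
      intro x hx
      rcases Finset.mem_insert.1 hx with rfl | hx
      · exact hu
      · rw [Finset.mem_singleton.1 hx]; exact hv) (by
      intro x hx hgx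
      have h3 := (hg'.2 u).2 hu
      have h4 := (hg'.2 v).2 hv
      simp only [Finset.mem_insert, Finset.mem_singleton] at hx hgx
      rcases hx with rfl | rfl
      · rcases hgx with e | e
        · exact h3 e
        · exact h e
      · rcases hgx with e | e
        · exact h2 e
        · exact h4 e)
  simp only [Finset.prod_pair huv] at e
  rw [← Ex_sv T g s hg (fun t => if u ∈ t ∧ v ∈ t then 1 else 0), ← e]
  congr 1
  funext O
  simp only [sv, ind, Finset.mem_filter, hu, hv, true_and]
  cases Outcome.beats O u (g u) <;> cases Outcome.beats O v (g v) <;> simp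

theorem isB_val {n : ℕ} {ε : ℝ} {T1 T0 : ProbTournament n} {u v x : Fin n}
    (H : Setup ε T1 T0 u v) (h : isB T1 u v x) : T1.p u x = 1/2 + ε ∧ T1.p v x = 1/2 - ε := by
  obtain ⟨h1, h2, h3⟩ := h
  have := H.eps0
  rcases H.typ x h1 h2 with e | e | e
  · linarith
  · exact e
  · linarith [e.1, e.2]

theorem GG_le_one {n : ℕ} (T : ProbTournament n) (u v : Fin n) (s : Finset (Fin n))
    (g : Fin n → Fin n) (hg : g ∈ Invo s) : GG T u v s g ≤ 1 := by
  rw [← pr_sum T g s hg]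
  unfold GG
  refine Finset.sum_le_sum (fun t _ => ?_)
  have := pr_nonneg T g s t
  split_ifs <;> linarith

theorem GG_nonneg {n : ℕ} (T : ProbTournament n) (u v : Fin n) (s : Finset (Fin n))
    (g : Fin n → Fin n) : 0 ≤ GG T u v s g := by
  unfold GG
  refine Finset.sum_nonneg (fun t _ => ?_)
  have := pr_nonneg T g s t
  split_ifs <;> linarith

theorem GG_le_u {n : ℕ} (T : ProbTournament n) (u v : Fin n) (s : Finset (Fin n))
    (g : Fin n → Fin n) (hg : g ∈ Invo s) (hu : u ∈ s) : GG T u v s g ≤ T.p u (g u) := by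
  rw [← marg1 T s g hg u hu]
  unfold GG
  refine Finset.sum_le_sum (fun t _ => mul_le_mul_of_nonneg_left ?_ (pr_nonneg T g s t))
  split_ifs <;> first | tauto | norm_num

theorem GG_le_v {n : ℕ} (T : ProbTournament n) (u v : Fin n) (s : Finset (Fin n))
    (g : Fin n → Fin n) (hg : g ∈ Invo s) (hv : v ∈ s) : GG T u v s g ≤ T.p v (g v) := by
  rw [← marg1 T s g hg v hv]
  unfold GG
  refine Finset.sum_le_sum (fun t _ => mul_le_mul_of_nonneg_left ?_ (pr_nonneg T g s t))
  split_ifs <;> first | tauto | norm_num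

theorem GG_le_uv {n : ℕ} (T : ProbTournament n) (u v : Fin n) (s : Finset (Fin n))
    (g : Fin n → Fin n) (hg : g ∈ Invo s) (hu : u ∈ s) (hv : v ∈ s) (huv : u ≠ v)
    (h : g u ≠ v) : GG T u v s g ≤ T.p u (g u) * T.p v (g v) := by
  rw [← marg2 T s g hg u v hu hv huv h]
  unfold GG
  refine Finset.sum_le_sum (fun t _ => mul_le_mul_of_nonneg_left ?_ (pr_nonneg T g s t))
  split_ifs <;> first | tauto | norm_num

/-- If all members of `B` in `s` are first round opponents of `u` or `v`, then `GG = 0`. -/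
theorem GG_zero {n : ℕ} (T : ProbTournament n) (u v : Fin n) (s : Finset (Fin n))
    (g : Fin n → Fin n) (hu : u ∈ s) (hv : v ∈ s)
    (h : ∀ x ∈ s, isB T u v x → x = g u ∨ x = g v) : GG T u v s g = 0 := by
  unfold GG
  refine Finset.sum_eq_zero (fun t ht => ?_)
  have hts := Finset.mem_powerset.1 ht
  by_cases htr : trv g s t
  · rw [if_neg, mul_zero]
    rintro ⟨h1, h2, x, hx, hb⟩
    rcases h x (hts hx) hb with rfl | rfl
    · exact (htr.2 u hu).1 h1 hx
    · exact (htr.2 v hv).1 h2 hx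
  · rw [pr, if_neg htr, zero_mul]


theorem cnt_perm {n : ℕ} (σ : Equiv.Perm (Fin n)) (s : Finset (Fin n))
    (hs : s.map σ.toEmbedding = s) (i j : Fin n) :
    ∑ g ∈ Invo s, (if g (σ i) = σ j then (1:ℝ) else 0) =
      ∑ g ∈ Invo s, (if g i = j then (1:ℝ) else 0) := by
  have h := Invo_sum_map σ.toEmbedding s (fun g => if g (σ i) = σ j then (1:ℝ) else 0)
  rw [hs] at h
  rw [h]
  refine Finset.sum_congr rfl (fun g _ => ?_)
  have := extG_apply σ.toEmbedding g i
  simp only [Equiv.coe_toEmbedding] at this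
  rw [this]
  simp

/-- Number of matchings in which `u` meets `v`. -/
noncomputable def qq {n : ℕ} (s : Finset (Fin n)) (u v : Fin n) : ℝ :=
  ∑ g ∈ Invo s, (if g u = v then (1:ℝ) else 0)

theorem qq_nonneg {n : ℕ} (s : Finset (Fin n)) (u v : Fin n) : 0 ≤ qq s u v := by
  unfold qq
  refine Finset.sum_nonneg (fun g _ => ?_)
  split_ifs <;> norm_num

theorem qq_u {n : ℕ} (s : Finset (Fin n)) (u v x : Fin n) (hv : v ∈ s)
    (hx : x ∈ s) (hxu : x ≠ u) (huv : u ≠ v) : qq s u x = qq s u v := by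
  have := cnt_perm (Equiv.swap v x) s (swap_map v x s hv hx) u v
  rw [Equiv.swap_apply_left, Equiv.swap_apply_of_ne_of_ne huv hxu.symm] at this
  exact this

theorem qq_symm {n : ℕ} (s : Finset (Fin n)) (u v : Fin n) : qq s u v = qq s v u := by
  unfold qq
  refine Finset.sum_congr rfl (fun g hg => ?_)
  have hg' := mem_Invo.1 hg
  have : g u = v ↔ g v = u := by
    constructor
    · rintro rfl; exact hg'.1 u
    · rintro rfl; exact hg'.1 v
  simp only [this]

theorem cnt_B {n : ℕ} (s B : Finset (Fin n)) (u v : Fin n) (hv : v ∈ s)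
    (hB : B ⊆ s) (huB : u ∉ B) (huv : u ≠ v) :
    ∑ g ∈ Invo s, (if g u ∈ B then (1:ℝ) else 0) = B.card * qq s u v := by
  have : ∀ g : Fin n → Fin n, (if g u ∈ B then (1:ℝ) else 0) =
      ∑ x ∈ B, if g u = x then (1:ℝ) else 0 := by
    intro g
    rw [Finset.sum_ite_eq]
  simp only [this]
  rw [Finset.sum_comm, ← nsmul_eq_mul, ← Finset.sum_const]
  refine Finset.sum_congr rfl (fun x hx => ?_)
  exact qq_u s u v x hv (hB hx) (fun e => huB (e ▸ hx)) huv

theorem finish {n : ℕ} {ε : ℝ} {T1 T0 : ProbTournament n} {u v : Fin n}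
    (H : Setup ε T1 T0 u v) (k : ℕ) (s : Finset (Fin n)) (hu : u ∈ s) (hv : v ∈ s)
    (hno : ∀ g ∈ Invo s, g u ≠ v → DD T1 T0 u v k s g ≤ 2 * ε / 3 * GG T1 u v s g)
    (al be : ℝ) (B : Finset (Fin n)) (hB : B = s.filter (isB T1 u v))
    (hsum : 2 ≤ (al + be) * B.card)
    (hG : ∀ g ∈ Invo s, g u ≠ v → GG T1 u v s g ≤
      1 - al * (if g u ∈ B then (1:ℝ) else 0) - be * (if g v ∈ B then (1:ℝ) else 0)) :
    SS T1 u v (k+1) s - SS T0 u v (k+1) s ≤ 2 * ε / 3 := by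
  have he0 := H.eps0
  rw [diff_step]
  apply avg_le _ _ _ (by linarith)
  have huB : u ∉ B := by
    rw [hB]; intro hh; exact (Finset.mem_filter.1 hh).2.1 rfl
  have hvB : v ∉ B := by
    rw [hB]; intro hh; exact (Finset.mem_filter.1 hh).2.2.1 rfl
  have hBs : B ⊆ s := by rw [hB]; exact Finset.filter_subset _ _
  have key : ∀ g ∈ Invo s, DD T1 T0 u v k s g ≤ 2 * ε / 3 * (1 + 2 * (if g u = v then (1:ℝ) else 0)
      - al * (if g u ∈ B then (1:ℝ) else 0) - be * (if g v ∈ B then (1:ℝ) else 0)) := by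
    intro g hg
    by_cases h : g u = v
    · have h2 : g v = u := by rw [← h, (mem_Invo.1 hg).1]
      have := (DD_match H k s hu hv g hg h).1
      rw [if_pos h, h, h2, if_neg hvB, if_neg huB]
      linarith
    · refine (hno g hg h).trans (mul_le_mul_of_nonneg_left ?_ (by linarith))
      have := hG g hg h
      rw [if_neg h]
      linarith
  refine (Finset.sum_le_sum key).trans ?_
  rw [← Finset.mul_sum]
  refine mul_le_mul_of_nonneg_left ?_ (by linarith)
  simp only [Finset.sum_sub_distrib, Finset.sum_add_distrib, ← Finset.mul_sum]
  rw [cnt_B s B u v hv hBs huB H.huv, cnt_B s B v u hu hBs hvB H.huv.symm, ← qq_symm s u v]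
  change _ + 2 * qq s u v - _ - _ ≤ _
  simp only [Finset.sum_const, nsmul_eq_mul, mul_one]
  have := mul_le_mul_of_nonneg_right hsum (qq_nonneg s u v)
  linarith

theorem main_claim {n : ℕ} {ε : ℝ} {T1 T0 : ProbTournament n} {u v : Fin n}
    (H : Setup ε T1 T0 u v) (k : ℕ) : ∀ s : Finset (Fin n), u ∈ s → v ∈ s →
      (SS T1 u v k s - SS T0 u v k s ≤ 2 * ε / 3 ∧
      ((∀ x ∈ s, ¬ isB T1 u v x) → SS T1 u v k s - SS T0 u v k s ≤ 0)) := by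
  have he0 := H.eps0
  have he1 := H.eps1
  induction k with
  | zero =>
    intro s _ _
    have : SS T1 u v 0 s - SS T0 u v 0 s = 0 := by simp [SS, EW]
    rw [this]
    exact ⟨by linarith, fun _ => le_refl _⟩
  | succ k ih =>
    intro s hu hv
    have hno : ∀ g ∈ Invo s, g u ≠ v → DD T1 T0 u v k s g ≤ 2 * ε / 3 * GG T1 u v s g :=
      fun g hg h => DD_nomatch H k s ih g hg h
    have hA : (∀ x ∈ s, ¬ isB T1 u v x) → SS T1 u v (k+1) s - SS T0 u v (k+1) s ≤ 0 := by
      intro hB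
      rw [diff_step]
      refine mul_nonpos_of_nonneg_of_nonpos (inv_nonneg.2 (Nat.cast_nonneg _))
        (Finset.sum_nonpos (fun g hg => ?_))
      by_cases h : g u = v
      · exact (DD_match H k s hu hv g hg h).2 hB
      · have := hno g hg h
        rw [GG_zero T1 u v s g hu hv (fun x hx hb => absurd hb (hB x hx))] at this
        linarith
    refine ⟨?_, hA⟩
    obtain ⟨B, hB⟩ : ∃ B, B = s.filter (isB T1 u v) := ⟨_, rfl⟩
    have memB : ∀ x, x ∈ B ↔ x ∈ s ∧ isB T1 u v x := by
      intro x; rw [hB, Finset.mem_filter]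
    -- common consequences
    have hval : ∀ x ∈ B, T1.p u x = 1/2 + ε ∧ T1.p v x = 1/2 - ε :=
      fun x hx => isB_val H ((memB x).1 hx).2
    have hinj : ∀ g ∈ Invo s, g u ≠ g v := by
      intro g hg e
      apply H.huv
      rw [← (mem_Invo.1 hg).1 u, e, (mem_Invo.1 hg).1]
    have hcases : B.card = 0 ∨ B.card = 1 ∨ B.card = 2 ∨ 3 ≤ B.card := by omega
    rcases hcases with hc | hc | hc | hc
    · rw [Finset.card_eq_zero] at hc
      have := hA (fun x hx hb => by
        have := (memB x).2 ⟨hx, hb⟩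
        rw [hc] at this
        exact absurd this (Finset.notMem_empty x))
      linarith
    · refine finish H k s hu hv hno 1 1 B hB (by rw [hc]; norm_num) ?_
      intro g hg h
      obtain ⟨x, hx⟩ := Finset.card_eq_one.1 hc
      have hne := hinj g hg
      have hxs : ∀ y ∈ s, isB T1 u v y → y = x := by
        intro y hy hb
        have := (memB y).2 ⟨hy, hb⟩
        rw [hx] at this
        exact Finset.mem_singleton.1 this
      rw [hx]
      simp only [Finset.mem_singleton]
      by_cases e1 : g u = x
      · have e2 : ¬ g v = x := fun e => hne (e1.trans e.symm)
        rw [GG_zero T1 u v s g hu hv (fun y hy hb => Or.inl ((hxs y hy hb).trans e1.symm))]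
        rw [if_pos e1, if_neg e2]
        norm_num
      · by_cases e2 : g v = x
        · rw [GG_zero T1 u v s g hu hv (fun y hy hb => Or.inr ((hxs y hy hb).trans e2.symm))]
          rw [if_neg e1, if_pos e2]
          norm_num
        · rw [if_neg e1, if_neg e2]
          have := GG_le_one T1 u v s g hg
          linarith
    · refine finish H k s hu hv hno (1/2 - ε) (1/2 + ε) B hB (by rw [hc]; norm_num) ?_
      intro g hg h
      have hne := hinj g hg
      by_cases e1 : g u ∈ B
      · by_cases e2 : g v ∈ B
        · have hBe : B = {g u, g v} := by
            symm
            apply Finset.eq_of_subset_of_card_le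
            · intro y hy
              rcases Finset.mem_insert.1 hy with rfl | hy
              · exact e1
              · rw [Finset.mem_singleton.1 hy]; exact e2
            · rw [hc, Finset.card_pair hne]
          rw [GG_zero T1 u v s g hu hv (fun y hy hb => by
            have := (memB y).2 ⟨hy, hb⟩
            rw [hBe] at this
            simpa using this)]
          rw [if_pos e1, if_pos e2]
          linarith
        · rw [if_pos e1, if_neg e2]
          have := GG_le_u T1 u v s g hg hu
          rw [(hval _ e1).1] at this
          linarith
      · by_cases e2 : g v ∈ B
        · rw [if_neg e1, if_pos e2]
          have := GG_le_v T1 u v s g hg hv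
          rw [(hval _ e2).2] at this
          linarith
        · rw [if_neg e1, if_neg e2]
          have := GG_le_one T1 u v s g hg
          linarith
    · have hc' : (3:ℝ) ≤ B.card := by exact_mod_cast hc
      refine finish H k s hu hv hno (3/4 * (1/2 - ε)) (3/4 * (1/2 + ε)) B hB (by linarith) ?_
      intro g hg h
      by_cases e1 : g u ∈ B
      · by_cases e2 : g v ∈ B
        · rw [if_pos e1, if_pos e2]
          have := GG_le_uv T1 u v s g hg hu hv H.huv h
          rw [(hval _ e1).1, (hval _ e2).2] at this
          nlinarith [sq_nonneg ε]
        · rw [if_pos e1, if_neg e2]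
          have := GG_le_u T1 u v s g hg hu
          rw [(hval _ e1).1] at this
          linarith
      · by_cases e2 : g v ∈ B
        · rw [if_neg e1, if_pos e2]
          have := GG_le_v T1 u v s g hg hv
          rw [(hval _ e2).2] at this
          linarith
        · rw [if_neg e1, if_neg e2]
          have := GG_le_one T1 u v s g hg
          linarith

/-! ## Reduction to extreme probabilities -/

/-- Situation in which the matches against teams of `A` are still arbitrary. -/
structure Pre {n : ℕ} (ε : ℝ) (A : Finset (Fin n)) (T1 T0 : ProbTournament n) (u v : Fin n) :
    Prop where
  h1 : T1.p u v = 1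
  h0 : T0.p u v = 0
  agree : ∀ i j, ¬ (i = u ∧ j = v) → ¬ (i = v ∧ j = u) → T1.p i j = T0.p i j
  box : ∀ x ∈ A, x ≠ u → x ≠ v → (T1.p u x ∈ Set.Icc (1/2 - ε) (1/2 + ε) ∧
    T1.p v x ∈ Set.Icc (1/2 - ε) (1/2 + ε))
  typ : ∀ x, x ∉ A → x ≠ u → x ≠ v → (T1.p u x = T1.p v x ∨
    (T1.p u x = 1/2 + ε ∧ T1.p v x = 1/2 - ε) ∨ (T1.p u x = 1/2 - ε ∧ T1.p v x = 1/2 + ε))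

theorem Pre_leaf {n : ℕ} {ε : ℝ} {A : Finset (Fin n)} {T1 T0 : ProbTournament n} {u v x : Fin n}
    (huv : u ≠ v) (hux : u ≠ x) (hvx : v ≠ x) (H : Pre ε (insert x A) T1 T0 u v)
    (r r' : ℝ) (hr : r ∈ Set.Icc (0:ℝ) 1) (hr' : r' ∈ Set.Icc (0:ℝ) 1)
    (hc : r = r' ∨ (r = 1/2 + ε ∧ r' = 1/2 - ε) ∨ (r = 1/2 - ε ∧ r' = 1/2 + ε)) (hxA : x ∉ A) :
    Pre ε A (setP (setP T1 u x hux r hr) v x hvx r' hr')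
      (setP (setP T0 u x hux r hr) v x hvx r' hr') u v := by
  have hu : ∀ (T : ProbTournament n) y, y ≠ u → y ≠ v → y ≠ x →
      (setP (setP T u x hux r hr) v x hvx r' hr').p u y = T.p u y := by
    intro T y h1 h2 h3
    simp [setP, h3, huv, hux]
  have hv : ∀ (T : ProbTournament n) y, y ≠ u → y ≠ v → y ≠ x →
      (setP (setP T u x hux r hr) v x hvx r' hr').p v y = T.p v y := by
    intro T y h1 h2 h3
    simp [setP, h3, huv.symm, hvx]
  have hux' : (setP (setP T1 u x hux r hr) v x hvx r' hr').p u x = r := by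
    simp [setP, huv, hux]
  have hvx' : (setP (setP T1 u x hux r hr) v x hvx r' hr').p v x = r' := by
    simp [setP]
  refine ⟨?_, ?_, ?_, ?_, ?_⟩
  · simp [setP, hvx, hux, huv, H.h1]
  · simp [setP, hvx, hux, huv, H.h0]
  · intro i j n1 n2
    simp only [setP]
    split_ifs <;> first | rfl | exact H.agree i j n1 n2
  · intro y hy yu yv
    have hyx : y ≠ x := fun e => hxA (e ▸ hy)
    rw [hu T1 y yu yv hyx, hv T1 y yu yv hyx]
    exact H.box y (Finset.mem_insert_of_mem hy) yu yv
  · intro y hy yu yv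
    by_cases hyx : y = x
    · subst hyx
      rw [hux', hvx']
      exact hc
    · rw [hu T1 y yu yv hyx, hv T1 y yu yv hyx]
      exact H.typ y (by simp [hyx, hy]) yu yv

theorem vary {n : ℕ} (ε : ℝ) (hε : 0 < ε) (c : ℝ) (T1 T0 : ProbTournament n) (u v : Fin n)
    (w x : Fin n) (hwx : w ≠ x) (heq : T1.p w x = T0.p w x)
    (hp : T1.p w x ∈ Set.Icc (1/2 - ε) (1/2 + ε))
    (ha : 1/2 + ε ∈ Set.Icc (0:ℝ) 1) (hd : 1/2 - ε ∈ Set.Icc (0:ℝ) 1) (k : ℕ)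
    (s : Finset (Fin n))
    (h1 : SS (setP T1 w x hwx _ ha) u v k s - SS (setP T0 w x hwx _ ha) u v k s ≤ c)
    (h2 : SS (setP T1 w x hwx _ hd) u v k s - SS (setP T0 w x hwx _ hd) u v k s ≤ c) :
    SS T1 u v k s - SS T0 u v k s ≤ c := by
  obtain ⟨l, hl⟩ : ∃ l, l = (T1.p w x - (1/2 - ε)) / (2 * ε) := ⟨_, rfl⟩
  have hl0 : 0 ≤ l := by
    rw [hl]; exact div_nonneg (by linarith [hp.1]) (by linarith)
  have hl1 : l ≤ 1 := by
    rw [hl, div_le_one (by linarith)]; linarith [hp.2]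
  have hq : T1.p w x = l * (1/2 + ε) + (1 - l) * (1/2 - ε) := by
    rw [hl]; field_simp; ring
  have key : ∀ T : ProbTournament n, T.p w x = T1.p w x → ∀ i,
      EW T k s i = l * EW (setP T w x hwx _ ha) k s i + (1 - l) * EW (setP T w x hwx _ hd) k s i := by
    intro T hT i
    apply EW_affine T _ _ w x hwx l
    · intro i j n1 n2; exact setP_other T w x hwx _ _ i j n1 n2
    · intro i j n1 n2; exact setP_other T w x hwx _ _ i j n1 n2
    · rw [setP_self, setP_self, hT, hq]
  unfold SS at *
  rw [key T1 rfl u, key T1 rfl v, key T0 heq.symm u, key T0 heq.symm v]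
  nlinarith [mul_le_mul_of_nonneg_left h1 hl0, mul_le_mul_of_nonneg_left h2 (sub_nonneg.2 hl1)]

theorem reduced {n : ℕ} (ε : ℝ) (hε : 0 ≤ ε) (hε1 : ε ≤ 1/2) (u v : Fin n) (huv : u ≠ v)
    (k : ℕ) (s : Finset (Fin n)) (hu : u ∈ s) (hv : v ∈ s) (A : Finset (Fin n)) :
    ∀ T1 T0 : ProbTournament n, Pre ε A T1 T0 u v →
      SS T1 u v k s - SS T0 u v k s ≤ 2 * ε / 3 := by
  induction A using Finset.induction_on with
  | empty =>
    intro T1 T0 H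
    have : Setup ε T1 T0 u v := ⟨hε, hε1, huv, H.h1, H.h0, H.agree,
      fun x h1 h2 => H.typ x (Finset.notMem_empty x) h1 h2⟩
    exact (main_claim this k s hu hv).1
  | insert x A hxA ih =>
    intro T1 T0 H
    have triv : (x ≠ u → x ≠ v → T1.p u x = T1.p v x) →
        SS T1 u v k s - SS T0 u v k s ≤ 2 * ε / 3 := by
      intro hx
      apply ih
      refine ⟨H.h1, H.h0, H.agree, fun y hy => H.box y (Finset.mem_insert_of_mem hy), ?_⟩
      intro y hy yu yv
      by_cases hyx : y = x
      · subst hyx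
        exact Or.inl (hx yu yv)
      · exact H.typ y (by simp [hyx, hy]) yu yv
    by_cases hxu : x = u
    · exact triv (fun h => absurd hxu h)
    by_cases hxv : x = v
    · exact triv (fun _ h => absurd hxv h)
    obtain ⟨b1, b2⟩ := H.box x (Finset.mem_insert_self _ _) hxu hxv
    rcases hε.eq_or_lt with h0 | hpos
    · apply triv
      intro _ _
      rw [← h0] at b1 b2
      linarith [b1.1, b1.2, b2.1, b2.2]
    have ha : 1/2 + ε ∈ Set.Icc (0:ℝ) 1 := ⟨by linarith, by linarith⟩
    have hd : 1/2 - ε ∈ Set.Icc (0:ℝ) 1 := ⟨by linarith, by linarith⟩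
    have hux : u ≠ x := fun e => hxu e.symm
    have hvx : v ≠ x := fun e => hxv e.symm
    have eu : T1.p u x = T0.p u x := H.agree _ _ (fun e => hxv e.2) (fun e => huv e.1)
    have ev : T1.p v x = T0.p v x := H.agree _ _ (fun e => huv e.1.symm) (fun e => hxu e.2)
    have eo : ∀ (T : ProbTournament n) (r : ℝ) (hr : r ∈ Set.Icc (0:ℝ) 1),
        (setP T u x hux r hr).p v x = T.p v x := by
      intro T r hr
      exact setP_other T u x hux r hr v x (fun e => huv e.1.symm) (fun e => hvx e.1)
    apply vary ε hpos _ T1 T0 u v u x hux eu b1 ha hd k s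
    · apply vary ε hpos _ _ _ u v v x hvx (by rw [eo, eo, ev]) (by rw [eo]; exact b2) ha hd k s
      · exact ih _ _ (Pre_leaf huv hux hvx H _ _ ha ha (Or.inl rfl) hxA)
      · exact ih _ _ (Pre_leaf huv hux hvx H _ _ ha hd (Or.inr (Or.inl ⟨rfl, rfl⟩)) hxA)
    · apply vary ε hpos _ _ _ u v v x hvx (by rw [eo, eo, ev]) (by rw [eo]; exact b2) ha hd k s
      · exact ih _ _ (Pre_leaf huv hux hvx H _ _ hd ha (Or.inr (Or.inr ⟨rfl, rfl⟩)) hxA)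
      · exact ih _ _ (Pre_leaf huv hux hvx H _ _ hd hd (Or.inl rfl) hxA)

/-! ## Adding dummies -/

theorem le_np (n : ℕ) : n ≤ nextPow2 n := Nat.le_pow_clog one_lt_two n

/-- The extended probabilistic tournament. -/
noncomputable def extT {n : ℕ} (T : ProbTournament n) : ProbTournament (nextPow2 n) where
  p i j := if hi : (i : ℕ) < n then (if hj : (j : ℕ) < n then T.p ⟨i, hi⟩ ⟨j, hj⟩ else 1)
    else if (j : ℕ) < n then 0 else if i < j then 1 else 0
  mem_Icc i j := by
    split_ifs
    · exact T.mem_Icc _ _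
    all_goals norm_num
  compl i j h := by
    by_cases hi : (i : ℕ) < n <;> by_cases hj : (j : ℕ) < n
    · simp only [hi, hj, dif_pos]
      apply T.compl
      intro e
      apply h
      simp only [Fin.mk.injEq] at e
      exact Fin.ext e
    · simp [hi, hj]
    · simp [hi, hj]
    · rcases lt_or_gt_of_ne h with hl | hl
      · simp [hi, hj, hl, hl.le]
      · simp [hi, hj, hl, hl.le]

theorem extT_real {n : ℕ} (T : ProbTournament n) (i j : Fin n) :
    (extT T).p (Fin.castLE (le_np n) i) (Fin.castLE (le_np n) j) = T.p i j := by
  simp [extT]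

theorem extT_dummy {n : ℕ} (T : ProbTournament n) (i : Fin n) (j : Fin (nextPow2 n))
    (hj : ¬ (j : ℕ) < n) : (extT T).p (Fin.castLE (le_np n) i) j = 1 := by
  simp [extT, hj]

/-- Embedding of matches. -/
def embM {n : ℕ} (e : MatchPair n) : MatchPair (nextPow2 n) :=
  ⟨(Fin.castLE (le_np n) e.val.1, Fin.castLE (le_np n) e.val.2), e.2⟩

theorem embM_inj (n : ℕ) : Function.Injective (embM (n := n)) := by
  intro e e' h
  have h1 := congrArg (fun q => q.val.1) h
  have h2 := congrArg (fun q => q.val.2) h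
  simp only [embM, Fin.castLE_inj] at h1 h2
  exact Subtype.ext (Prod.ext h1 h2)

theorem extend_embM {n : ℕ} (o : Outcome n) (e : MatchPair n) :
    extendOutcome o (embM e) = o e := by
  have h : e.val.1 < e.val.2 := e.2
  simp [extendOutcome, embM, Outcome.beats, h]

theorem extend_not {n : ℕ} (o : Outcome n) (e : MatchPair (nextPow2 n))
    (h : ¬ (e.val.2 : ℕ) < n) : extendOutcome o e = true := by
  simp [extendOutcome, h]

theorem range_embM {n : ℕ} (e : MatchPair (nextPow2 n)) (h : (e.val.2 : ℕ) < n) :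
    ∃ e', embM e' = e := by
  have hl : e.val.1 < e.val.2 := e.2
  refine ⟨⟨(⟨e.val.1, lt_trans (Fin.lt_def.1 hl) h⟩, ⟨e.val.2, h⟩), Fin.lt_def.1 hl⟩, ?_⟩
  rfl

theorem prob_ext {n : ℕ} (T : ProbTournament n) (o : Outcome n) :
    T.prob o = (extT T).prob (extendOutcome o) := by
  rw [prob_eq, prob_eq]
  apply Fintype.prod_of_injective embM (embM_inj n)
  · intro e he
    have h : ¬ (e.val.2 : ℕ) < n := fun h => he (range_embM e h)
    have hl : e.val.1 < e.val.2 := e.2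
    rw [extend_not o e h]
    simp [wt, extT, h, hl]
  · intro e
    rw [extend_embM]
    have h1 : (embM e).val.1 = Fin.castLE (le_np n) e.val.1 := rfl
    have h2 : (embM e).val.2 = Fin.castLE (le_np n) e.val.2 := rfl
    unfold wt
    rw [h1, h2, extT_real, extT_real]

theorem Ex_ext {n : ℕ} (T : ProbTournament n) (f : Outcome (nextPow2 n) → ℝ) :
    Ex T (fun o => f (extendOutcome o)) = Ex (extT T) f := by
  unfold Ex
  apply Fintype.sum_of_injective extendOutcome
  · intro o o' h
    funext e
    rw [← extend_embM o, ← extend_embM o', h]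
  · intro O hO
    have : ∃ e : MatchPair (nextPow2 n), ¬ (e.val.2 : ℕ) < n ∧ O e = false := by
      by_contra hcon
      push Not at hcon
      apply hO
      refine ⟨fun e => O (embM e), ?_⟩
      funext e
      by_cases h : (e.val.2 : ℕ) < n
      · obtain ⟨e', rfl⟩ := range_embM e h
        rw [extend_embM]
      · rw [extend_not _ e h]
        have := hcon e (not_lt.1 h)
        simpa using this.symm
    obtain ⟨e, h1, h2⟩ := this
    have hl : e.val.1 < e.val.2 := e.2
    rw [prob_eq, Finset.prod_eq_zero (Finset.mem_univ e), zero_mul]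
    simp [wt, h2, extT, h1, hl.le]
  · intro o
    rw [prob_ext]

theorem rP_eq {n : ℕ} (T : ProbTournament n) (i : Fin n) :
    rP RSEB T i = EW (extT T) (Nat.clog 2 n) Finset.univ (Fin.castLE (le_np n) i) := by
  rw [← Ex_winP, ← Ex_ext T (fun O => winP (Nat.clog 2 n) Finset.univ (Outcome.beats O)
    (Fin.castLE (le_np n) i))]
  unfold rP Ex
  refine Finset.sum_congr rfl (fun o _ => ?_)
  congr 1
  unfold RSEB
  exact RSEBAux_eq_winP (Nat.clog 2 n) (nextPow2 n) (nextPow2 n) (extendOutcome o) _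
    (Nat.lt_two_pow_self).le rfl

theorem cast_ne {n : ℕ} {u v : Fin n} (h : u ≠ v) :
    Fin.castLE (le_np n) u ≠ Fin.castLE (le_np n) v := by
  simpa using h

theorem one_mem : (1:ℝ) ∈ Set.Icc (0:ℝ) 1 := ⟨zero_le_one, le_refl _⟩
theorem zero_mem : (0:ℝ) ∈ Set.Icc (0:ℝ) 1 := ⟨le_refl _, zero_le_one⟩

theorem SS_affine {n : ℕ} (T T' : ProbTournament n) (u v : Fin n) (huv : u ≠ v)
    (hadj : ∀ i j, i ≠ j → ¬ (i = u ∧ j = v) → ¬ (i = v ∧ j = u) → T'.p i j = T.p i j)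
    (k : ℕ) (s : Finset (Fin n)) :
    SS T' u v k s = T'.p u v * SS (setP T u v huv 1 one_mem) u v k s +
      (1 - T'.p u v) * SS (setP T u v huv 0 zero_mem) u v k s := by
  have hl : ∀ i, EW T' k s i = EW (setP T u v huv (T'.p u v) (T'.mem_Icc u v)) k s i := by
    intro i
    apply EW_local
    intro a _ b _ hab
    by_cases h1 : a = u ∧ b = v
    · obtain ⟨rfl, rfl⟩ := h1
      rw [setP_self]
    · by_cases h2 : a = v ∧ b = u
      · obtain ⟨rfl, rfl⟩ := h2
        have := T'.compl _ _ hab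
        simp [setP, hab]
        linarith
      · rw [setP_other _ _ _ _ _ _ _ _ h1 h2]
        exact hadj a b hab h1 h2
  have ha : ∀ i, EW (setP T u v huv (T'.p u v) (T'.mem_Icc u v)) k s i =
      T'.p u v * EW (setP T u v huv 1 one_mem) k s i +
      (1 - T'.p u v) * EW (setP T u v huv 0 zero_mem) k s i := by
    intro i
    apply EW_affine _ _ _ u v huv
    · intro a b h1 h2
      rw [setP_other _ _ _ _ _ _ _ _ h1 h2, setP_other _ _ _ _ _ _ _ _ h1 h2]
    · intro a b h1 h2
      rw [setP_other _ _ _ _ _ _ _ _ h1 h2, setP_other _ _ _ _ _ _ _ _ h1 h2]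
    · rw [setP_self, setP_self, setP_self]; ring
  unfold SS
  rw [hl, hl, ha, ha]
  ring

theorem rPS_eq {n : ℕ} (T : ProbTournament n) (u v : Fin n) (huv : u ≠ v) :
    rPS RSEB T {u, v} = SS (extT T) (Fin.castLE (le_np n) u) (Fin.castLE (le_np n) v)
      (Nat.clog 2 n) Finset.univ := by
  unfold rPS SS
  rw [Finset.sum_pair huv, rP_eq, rP_eq]

theorem gain_eq {n : ℕ} (T T' : ProbTournament n) (u v : Fin n) (huv : u ≠ v)
    (hadj : Adjacent {u, v} T T') :
    rPS RSEB T' {u, v} - rPS RSEB T {u, v} = (T'.p u v - T.p u v) *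
      (SS (setP (extT T) _ _ (cast_ne huv) 1 one_mem) (Fin.castLE (le_np n) u)
        (Fin.castLE (le_np n) v) (Nat.clog 2 n) Finset.univ -
      SS (setP (extT T) _ _ (cast_ne huv) 0 zero_mem) (Fin.castLE (le_np n) u)
        (Fin.castLE (le_np n) v) (Nat.clog 2 n) Finset.univ) := by
  rw [rPS_eq T u v huv, rPS_eq T' u v huv,
    SS_affine (extT T) (extT T') _ _ (cast_ne huv),
    SS_affine (extT T) (extT T) _ _ (cast_ne huv) (fun _ _ _ _ _ => rfl), extT_real, extT_real]
  · ring
  · intro i j hij h1 h2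
    by_cases hi : (i : ℕ) < n <;> by_cases hj : (j : ℕ) < n
    · obtain ⟨i', rfl⟩ : ∃ i', Fin.castLE (le_np n) i' = i := ⟨⟨i, hi⟩, rfl⟩
      obtain ⟨j', rfl⟩ : ∃ j', Fin.castLE (le_np n) j' = j := ⟨⟨j, hj⟩, rfl⟩
      rw [extT_real, extT_real]
      simp only [Fin.castLE_inj] at h1 h2
      have hij' : i' ≠ j' := fun e => hij (by rw [e])
      refine (hadj i' j' ?_).symm
      simp only [Finset.mem_insert, Finset.mem_singleton]
      rintro ⟨rfl | rfl, rfl | rfl⟩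
      · exact hij' rfl
      · exact h1 ⟨rfl, rfl⟩
      · exact h2 ⟨rfl, rfl⟩
      · exact hij' rfl
    · simp [extT, hi, hj]
    · simp [extT, hi, hj]
    · simp [extT, hi, hj]

theorem upper {n : ℕ} (ε : ℝ) (hε : 0 ≤ ε) (hε1 : ε ≤ 1/2) (T T' : ProbTournament n)
    (u v : Fin n) (huv : u ≠ v) (hw : WeaklyBounded ε n T) (hadj : Adjacent {u, v} T T') :
    rPS RSEB T' {u, v} - rPS RSEB T {u, v} ≤ ε/3 + 2*ε^2/3 := by
  rw [gain_eq T T' u v huv hadj]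
  have hUV := cast_ne huv
  obtain ⟨U, hU⟩ : ∃ U, U = Fin.castLE (le_np n) u := ⟨_, rfl⟩
  obtain ⟨V, hV⟩ : ∃ V, V = Fin.castLE (le_np n) v := ⟨_, rfl⟩
  have hUV : U ≠ V := by rw [hU, hV]; exact cast_ne huv
  have hbox : ∀ x : Fin (nextPow2 n), (x : ℕ) < n → x ≠ U → x ≠ V →
      (extT T).p U x ∈ Set.Icc (1/2 - ε) (1/2 + ε) ∧
      (extT T).p V x ∈ Set.Icc (1/2 - ε) (1/2 + ε) := by
    intro x hx h1 h2
    obtain ⟨x', rfl⟩ : ∃ i', Fin.castLE (le_np n) i' = x := ⟨⟨x, hx⟩, rfl⟩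
    rw [hU, hV, extT_real, extT_real]
    exact ⟨hw u x' (fun e => h1 (by rw [hU, e])), hw v x' (fun e => h2 (by rw [hV, e]))⟩
  have hdum : ∀ x : Fin (nextPow2 n), ¬ (x : ℕ) < n →
      (extT T).p U x = (extT T).p V x := by
    intro x hx
    rw [hU, hV, extT_dummy T u x hx, extT_dummy T v x hx]
  have hpu : ∀ (r : ℝ) (hr : r ∈ Set.Icc (0:ℝ) 1) x, x ≠ U → x ≠ V →
      (setP (extT T) U V hUV r hr).p U x = (extT T).p U x :=
    fun r hr x h1 h2 => setP_other _ _ _ _ _ _ _ _ (fun e => h2 e.2) (fun e => h1 e.2)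
  have hpv : ∀ (r : ℝ) (hr : r ∈ Set.Icc (0:ℝ) 1) x, x ≠ U → x ≠ V →
      (setP (extT T) U V hUV r hr).p V x = (extT T).p V x :=
    fun r hr x h1 h2 => setP_other _ _ _ _ _ _ _ _ (fun e => h2 e.2) (fun e => h1 e.2)
  have hvu : ∀ (r : ℝ) (hr : r ∈ Set.Icc (0:ℝ) 1),
      (setP (extT T) U V hUV r hr).p V U = 1 - r := by
    intro r hr
    simp [setP, hUV]
  have P1 : Pre ε (Finset.univ.filter (fun x : Fin (nextPow2 n) => (x : ℕ) < n))
      (setP (extT T) U V hUV 1 one_mem) (setP (extT T) U V hUV 0 zero_mem) U V := by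
    refine ⟨setP_self _ _ _ _ _ _, setP_self _ _ _ _ _ _, ?_, ?_, ?_⟩
    · intro i j h1 h2
      rw [setP_other _ _ _ _ _ _ _ _ h1 h2, setP_other _ _ _ _ _ _ _ _ h1 h2]
    · intro x hx h1 h2
      rw [hpu _ _ x h1 h2, hpv _ _ x h1 h2]
      exact hbox x (by simpa using hx) h1 h2
    · intro x hx h1 h2
      rw [hpu _ _ x h1 h2, hpv _ _ x h1 h2]
      exact Or.inl (hdum x (by simpa using hx))
  have P2 : Pre ε (Finset.univ.filter (fun x : Fin (nextPow2 n) => (x : ℕ) < n))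
      (setP (extT T) U V hUV 0 zero_mem) (setP (extT T) U V hUV 1 one_mem) V U := by
    refine ⟨by rw [hvu]; norm_num, by rw [hvu]; norm_num, ?_, ?_, ?_⟩
    · intro i j h1 h2
      rw [setP_other _ _ _ _ _ _ _ _ h2 h1, setP_other _ _ _ _ _ _ _ _ h2 h1]
    · intro x hx h2 h1
      rw [hpu _ _ x h1 h2, hpv _ _ x h1 h2]
      exact (hbox x (by simpa using hx) h1 h2).symm
    · intro x hx h2 h1
      rw [hpu _ _ x h1 h2, hpv _ _ x h1 h2]
      exact Or.inl (hdum x (by simpa using hx)).symm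
  have b1 := reduced ε hε hε1 U V hUV (Nat.clog 2 n) Finset.univ (Finset.mem_univ _)
    (Finset.mem_univ _) _ _ _ P1
  have b2 := reduced ε hε hε1 V U hUV.symm (Nat.clog 2 n) Finset.univ (Finset.mem_univ _)
    (Finset.mem_univ _) _ _ _ P2
  have sy : ∀ X : ProbTournament (nextPow2 n), SS X V U (Nat.clog 2 n) Finset.univ =
      SS X U V (Nat.clog 2 n) Finset.univ := fun X => add_comm _ _
  rw [sy, sy] at b2
  subst hU hV
  have hp := hw u v huv
  have hp' := T'.mem_Icc u v
  generalize SS (setP (extT T) _ _ (cast_ne huv) 1 one_mem) (Fin.castLE (le_np n) u)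
        (Fin.castLE (le_np n) v) (Nat.clog 2 n) Finset.univ = A at *
  generalize SS (setP (extT T) _ _ (cast_ne huv) 0 zero_mem) (Fin.castLE (le_np n) u)
        (Fin.castLE (le_np n) v) (Nat.clog 2 n) Finset.univ = B at *
  have d1 : T'.p u v - T.p u v ≤ 1/2 + ε := by linarith [hp.1, hp'.2]
  have d2 : -(1/2 + ε) ≤ T'.p u v - T.p u v := by linarith [hp.2, hp'.1]
  have : |T'.p u v - T.p u v| * |A - B| ≤ (1/2 + ε) * (2 * ε / 3) :=
    mul_le_mul (abs_le.2 ⟨d2, d1⟩) (abs_le.2 ⟨by linarith, b1⟩) (abs_nonneg _) (by linarith)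
  rw [← abs_mul] at this
  have := (le_abs_self _).trans this
  linarith

/-! ## The lower bound -/

theorem EW_pair {n : ℕ} (T : ProbTournament n) (a b : Fin n) (hab : a ≠ b) :
    EW T 1 {a, b} a = T.p a b := by
  have ha : a ∈ ({a, b} : Finset (Fin n)) := by simp
  rw [EW]
  have h1 : ∀ g ∈ Invo ({a, b} : Finset (Fin n)),
      ∑ t ∈ ({a, b} : Finset (Fin n)).powerset, pr T g {a, b} t * EW T 0 t a = T.p a b := by
    intro g hg
    have := marg1 T {a, b} g hg a ha
    have hga : g a = b := by
      have h1 := Invo_mem hg ha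
      have h2 := ((mem_Invo.1 hg).2 a).2 ha
      simp only [Finset.mem_insert, Finset.mem_singleton] at h1
      exact h1.resolve_left h2
    rw [hga] at this
    simpa only [EW] using this
  rw [Finset.sum_congr rfl h1, Finset.sum_const, nsmul_eq_mul]
  have hne : (Invo ({a, b} : Finset (Fin n))).card ≠ 0 := by
    apply Finset.card_ne_zero_of_mem (a := fun x => Equiv.swap a b x)
    rw [mem_Invo]
    refine ⟨fun i => Equiv.swap_apply_self a b i, fun i => ?_⟩
    simp only [Finset.mem_insert, Finset.mem_singleton]
    by_cases h1 : i = a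
    · subst h1; simp [hab.symm]
    · by_cases h2 : i = b
      · subst h2; simp [hab]
      · rw [Equiv.swap_apply_of_ne_of_ne h1 h2]; simp [h1, h2]
  have : ((Invo ({a, b} : Finset (Fin n))).card : ℝ) ≠ 0 := by exact_mod_cast hne
  field_simp

theorem Setup_symm {n : ℕ} {ε : ℝ} {T1 T0 : ProbTournament n} {u v : Fin n}
    (H : Setup ε T1 T0 u v) : Setup ε T0 T1 v u := by
  have c1 := T1.compl u v H.huv
  have c0 := T0.compl u v H.huv
  rw [H.h1] at c1
  rw [H.h0] at c0
  refine ⟨H.eps0, H.eps1, H.huv.symm, by linarith, by linarith,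
    fun i j h1 h2 => (H.agree i j h2 h1).symm, fun x h1 h2 => ?_⟩
  rw [← H.agree u x (fun e => h1 e.2) (fun e => h2 e.2),
    ← H.agree v x (fun e => h1 e.2) (fun e => h2 e.2)]
  rcases H.typ x h2 h1 with h | h | h
  · exact Or.inl h.symm
  · exact Or.inr (Or.inr h.symm)
  · exact Or.inr (Or.inl h.symm)

theorem DD_neg {n : ℕ} (T1 T0 : ProbTournament n) (u v : Fin n) (k : ℕ)
    (s : Finset (Fin n)) (g : Fin n → Fin n) : DD T0 T1 v u k s g = - DD T1 T0 u v k s g := by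
  unfold DD SS
  rw [← Finset.sum_neg_distrib]
  refine Finset.sum_congr rfl (fun t _ => ?_)
  ring

theorem four {n : ℕ} {ε : ℝ} {T1 T0 : ProbTournament n} {u v w d : Fin n}
    (H : Setup ε T1 T0 u v) (huw : u ≠ w) (hud : u ≠ d) (hvw : v ≠ w) (hvd : v ≠ d) (hwd : w ≠ d)
    (hall : ∀ x, x = u ∨ x = v ∨ x = w ∨ x = d) (h1 : T1.p u w = 1/2 + ε)
    (h2 : T1.p v w = 1/2 - ε) (h3 : T1.p w d = 1) :
    SS T1 u v 2 Finset.univ - SS T0 u v 2 Finset.univ = 2 * ε / 3 := by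
  have huv := H.huv
  have mU : ∀ x : Fin n, x ∈ (Finset.univ : Finset (Fin n)) := Finset.mem_univ
  have H' := Setup_symm H
  have key : ∀ g ∈ Invo (Finset.univ : Finset (Fin n)),
      DD T1 T0 u v 1 Finset.univ g = 2 * ε * (if g u = v then 1 else 0) := by
    intro g hg
    have hg' := mem_Invo.1 hg
    have hfix : ∀ x, g x ≠ x := fun x => (hg'.2 x).2 (mU x)
    have ginj : ∀ x y, g x = g y → x = y := fun x y e => by rw [← hg'.1 x, e, hg'.1]
    by_cases h : g u = v
    · have hgv : g v = u := by rw [← h, hg'.1]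
      have hgd : g d = w := by
        rcases hall (g d) with e | e | e | e
        · exact absurd (ginj d v (e.trans hgv.symm)) hvd.symm
        · exact absurd (ginj d u (e.trans h.symm)) hud.symm
        · exact e
        · exact absurd e (hfix d)
      have hgw : g w = d := by rw [← hgd, hg'.1]
      rw [if_pos h, mul_one, DD_match_eq H 1 _ (mU u) (mU v) g hg h]
      have e : ∑ t ∈ (Finset.univ : Finset (Fin n)).powerset, pr T1 g Finset.univ t * (2 * ε) =
          2 * ε := by
        rw [← Finset.sum_mul, pr_sum _ _ _ hg, one_mul]
      rw [← e]
      refine Finset.sum_congr rfl (fun t ht => ?_)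
      have c1 := T1.compl u v huv
      rw [H.h1] at c1
      have c2 := T1.compl w d hwd
      rw [h3] at c2
      by_cases htr : trv g Finset.univ t
      · by_cases hvt : v ∈ t
        · rw [pr_eq_zero T1 g _ t v hvt (by rw [hgv]; linarith), zero_mul, zero_mul]
        · by_cases hdt : d ∈ t
          · rw [pr_eq_zero T1 g _ t d hdt (by rw [hgd]; linarith), zero_mul, zero_mul]
          · have hut : u ∈ t := by rw [htr.2 u (mU u), h]; exact hvt
            have hwt : w ∈ t := by rw [htr.2 w (mU w), hgw]; exact hdt
            have ht2 : t = {u, w} := by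
              ext x
              simp only [Finset.mem_insert, Finset.mem_singleton]
              constructor
              · intro hx
                rcases hall x with rfl | rfl | rfl | rfl
                · exact Or.inl rfl
                · exact absurd hx hvt
                · exact Or.inr rfl
                · exact absurd hx hdt
              · rintro (rfl | rfl)
                · exact hut
                · exact hwt
            congr 1
            unfold SS
            rw [EW_notMem _ _ _ _ hvt, EW_notMem _ _ _ _ hvt, ht2, EW_pair _ _ _ huw,
              EW_pair _ _ _ huw]
            simp only [permT]
            rw [Equiv.swap_apply_left, Equiv.swap_apply_of_ne_of_ne huw.symm hvw.symm,
              ← H.agree v w (fun e => huv e.1.symm) (fun e => huw e.2.symm), h1, h2]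
            ring
      · rw [pr, if_neg htr, zero_mul, zero_mul]
    · have hgv : g v ≠ u := by intro e; apply h; rw [← e, hg'.1]
      have hx : ∀ x, x ≠ u → x ≠ v → x = g u ∨ x = g v := by
        intro x xu xv
        by_contra hcon
        push Not at hcon
        -- g x avoids everything
        rcases hall (g u) with e | e | e | e
        · exact hfix u e
        · exact h e
        · rcases hall (g v) with e' | e' | e' | e'
          · exact hgv e'
          · exact hfix v e'
          · exact huv (ginj _ _ (e.trans e'.symm))
          · rcases hall x with e'' | e'' | e'' | e''
            · exact xu e''
            · exact xv e''
            · exact hcon.1 (e''.trans e.symm)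
            · exact hcon.2 (e''.trans e'.symm)
        · rcases hall (g v) with e' | e' | e' | e'
          · exact hgv e'
          · exact hfix v e'
          · rcases hall x with e'' | e'' | e'' | e''
            · exact xu e''
            · exact xv e''
            · exact hcon.2 (e''.trans e'.symm)
            · exact hcon.1 (e''.trans e.symm)
          · exact huv (ginj _ _ (e.trans e'.symm))
      have a1 := DD_nomatch H 1 Finset.univ (main_claim H 1) g hg h
      rw [GG_zero T1 u v _ g (mU u) (mU v) (fun x _ hb => hx x hb.1 hb.2.1)] at a1
      have a2 := DD_nomatch H' 1 Finset.univ (main_claim H' 1) g hg hgv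
      rw [GG_zero T0 v u _ g (mU v) (mU u) (fun x _ hb => (hx x hb.2.1 hb.1).symm), DD_neg] at a2
      rw [if_neg h]
      linarith
  rw [diff_step, Finset.sum_congr rfl key, ← Finset.mul_sum]
  change _ * (2 * ε * qq Finset.univ u v) = _
  have hcard : ((Invo (Finset.univ : Finset (Fin n))).card : ℝ) = 3 * qq Finset.univ u v := by
    have := cnt_B (Finset.univ : Finset (Fin n)) {v, w, d} u v (mU v) (Finset.subset_univ _)
      (by simp [huv, huw, hud]) huv
    have c3 : ({v, w, d} : Finset (Fin n)).card = 3 := by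
      rw [Finset.card_insert_of_notMem (by simp [hvw, hvd]), Finset.card_pair hwd]
    rw [c3] at this
    push_cast at this
    rw [← this, Finset.sum_congr rfl (g := fun _ => (1:ℝ)) (fun g hg => if_pos (by
      have hf : g u ≠ u := ((mem_Invo.1 hg).2 u).2 (mU u)
      simp only [Finset.mem_insert, Finset.mem_singleton]
      exact (hall (g u)).resolve_left hf))]
    simp
  have hq : qq (Finset.univ : Finset (Fin n)) u v ≠ 0 := by
    intro h0
    rw [h0, mul_zero] at hcard
    have h0 : (Invo (Finset.univ : Finset (Fin n))).card ≠ 0 := by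
      apply Finset.card_ne_zero_of_mem (a := fun x => Equiv.swap u v (Equiv.swap w d x))
      rw [mem_Invo]
      have s1 : Equiv.swap u v w = w := Equiv.swap_apply_of_ne_of_ne huw.symm hvw.symm
      have s2 : Equiv.swap u v d = d := Equiv.swap_apply_of_ne_of_ne hud.symm hvd.symm
      have s3 : Equiv.swap w d u = u := Equiv.swap_apply_of_ne_of_ne huw hud
      have s4 : Equiv.swap w d v = v := Equiv.swap_apply_of_ne_of_ne hvw hvd
      constructor
      · intro i
        rcases hall i with rfl | rfl | rfl | rfl <;> simp [s1, s2, s3, s4]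
      · intro i
        rcases hall i with rfl | rfl | rfl | rfl <;>
          simp [s1, s2, s3, s4, huv, huv.symm, hwd, hwd.symm]
    exact h0 (by exact_mod_cast hcard)
  rw [hcard]
  field_simp

/-- All matches are fair. -/
noncomputable def fairT (n : ℕ) : ProbTournament n where
  p _ _ := 1/2
  mem_Icc _ _ := ⟨by norm_num, by norm_num⟩
  compl _ _ _ := by norm_num

theorem h01 : (0 : Fin 3) ≠ 1 := by decide
theorem h02 : (0 : Fin 3) ≠ 2 := by decide
theorem h12 : (1 : Fin 3) ≠ 2 := by decide

/-- The extremal example. -/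
noncomputable def exT (ε : ℝ) (ha : 1/2 + ε ∈ Set.Icc (0:ℝ) 1) (hd : 1/2 - ε ∈ Set.Icc (0:ℝ) 1)
    (r : ℝ) (hr : r ∈ Set.Icc (0:ℝ) 1) : ProbTournament 3 :=
  setP (setP (setP (fairT 3) 0 2 h02 _ ha) 1 2 h12 _ hd) 0 1 h01 r hr

theorem lower (ε : ℝ) (hε : 0 ≤ ε) (hε1 : ε ≤ 1/2) :
    ∃ T T' : ProbTournament 3, WeaklyBounded ε 3 T ∧ Adjacent {0, 1} T T' ∧
      rPS RSEB T' {0, 1} - rPS RSEB T {0, 1} = ε/3 + 2*ε^2/3 := by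
  have ha : 1/2 + ε ∈ Set.Icc (0:ℝ) 1 := ⟨by linarith, by linarith⟩
  have hd : 1/2 - ε ∈ Set.Icc (0:ℝ) 1 := ⟨by linarith, by linarith⟩
  have hadj : Adjacent {0, 1} (exT ε ha hd _ hd) (exT ε ha hd 1 one_mem) := by
    intro i j h
    unfold exT
    have h1 : ¬ (i = 0 ∧ j = 1) := fun e => h (by simp [e.1, e.2])
    have h2 : ¬ (i = 1 ∧ j = 0) := fun e => h (by simp [e.1, e.2])
    rw [setP_other _ _ _ _ _ _ _ _ h1 h2, setP_other _ _ _ _ _ _ _ _ h1 h2]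
  refine ⟨exT ε ha hd _ hd, exT ε ha hd 1 one_mem, ?_, hadj, ?_⟩
  · intro i j hij
    simp only [exT, setP, fairT]
    split_ifs <;> constructor <;> linarith
  · rw [gain_eq _ _ _ _ h01 hadj]
    have hk : Nat.clog 2 3 = 2 := by decide
    have hN : nextPow2 3 = 4 := by decide
    have e1 : (exT ε ha hd _ hd).p 0 2 = 1/2 + ε := by simp [exT, setP]
    have e2 : (exT ε ha hd _ hd).p 1 2 = 1/2 - ε := by simp [exT, setP]
    have e3 : (exT ε ha hd _ hd).p 0 1 = 1/2 - ε := by simp [exT, setP]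
    have e4 : (exT ε ha hd 1 one_mem).p 0 1 = 1 := by simp [exT, setP]
    obtain ⟨X, hX⟩ : ∃ X, X = exT ε ha hd _ hd := ⟨_, rfl⟩
    rw [← hX] at e1 e2 e3 ⊢
    have d3 : ¬ (((⟨3, by rw [hN]; norm_num⟩ : Fin (nextPow2 3)) : ℕ) < 3) := by simp
    obtain ⟨d, hd3⟩ : ∃ d : Fin (nextPow2 3), d = ⟨3, by rw [hN]; norm_num⟩ := ⟨_, rfl⟩
    rw [← hd3] at d3
    have hne : ∀ a b : Fin 3, a ≠ b → Fin.castLE (le_np 3) a ≠ Fin.castLE (le_np 3) b :=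
      fun a b h => cast_ne h
    have hned : ∀ a : Fin 3, Fin.castLE (le_np 3) a ≠ d := by
      rintro a rfl
      exact d3 a.2
    have hall : ∀ x : Fin (nextPow2 3), x = Fin.castLE (le_np 3) 0 ∨ x = Fin.castLE (le_np 3) 1 ∨
        x = Fin.castLE (le_np 3) 2 ∨ x = d := by
      intro x
      have hx : (x : ℕ) < 4 := by rw [← hN]; exact x.2
      have hc : (x : ℕ) = 0 ∨ (x : ℕ) = 1 ∨ (x : ℕ) = 2 ∨ (x : ℕ) = 3 := by omega
      rcases hc with h | h | h | h
      · exact Or.inl (Fin.ext h)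
      · exact Or.inr (Or.inl (Fin.ext h))
      · exact Or.inr (Or.inr (Or.inl (Fin.ext h)))
      · exact Or.inr (Or.inr (Or.inr (by rw [hd3]; exact Fin.ext h)))
    have hpx : ∀ (r : ℝ) (hr : r ∈ Set.Icc (0:ℝ) 1) (i : Fin 3) (x : Fin (nextPow2 3)),
        x ≠ Fin.castLE (le_np 3) 0 → x ≠ Fin.castLE (le_np 3) 1 →
        (setP (extT X) _ _ (cast_ne h01) r hr).p (Fin.castLE (le_np 3) i) x =
          (extT X).p (Fin.castLE (le_np 3) i) x :=
      fun r hr i x h1 h2 => setP_other _ _ _ _ _ _ _ _ (fun e => h2 e.2) (fun e => h1 e.2)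
    have H : Setup ε (setP (extT X) _ _ (cast_ne h01) 1 one_mem)
        (setP (extT X) _ _ (cast_ne h01) 0 zero_mem)
        (Fin.castLE (le_np 3) 0) (Fin.castLE (le_np 3) 1) := by
      refine ⟨hε, hε1, cast_ne h01, setP_self _ _ _ _ _ _, setP_self _ _ _ _ _ _, ?_, ?_⟩
      · intro i j h1 h2
        rw [setP_other _ _ _ _ _ _ _ _ h1 h2, setP_other _ _ _ _ _ _ _ _ h1 h2]
      · intro x h1 h2
        rw [hpx _ _ _ x h1 h2, hpx _ _ _ x h1 h2]
        rcases hall x with h | h | h | h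
        · exact absurd h h1
        · exact absurd h h2
        · rw [h, extT_real, extT_real]
          exact Or.inr (Or.inl ⟨e1, e2⟩)
        · rw [h, extT_dummy _ _ _ d3, extT_dummy _ _ _ d3]
          exact Or.inl rfl
    have F := four H (hne _ _ h02) (hned 0) (hne _ _ h12) (hned 1) (hned 2) hall
      (by rw [hpx _ _ _ _ (hne _ _ h02.symm) (hne _ _ h12.symm), extT_real, e1])
      (by rw [hpx _ _ _ _ (hne _ _ h02.symm) (hne _ _ h12.symm), extT_real, e2])
      (by rw [hpx _ _ _ _ (hned 0).symm (hned 1).symm, extT_dummy _ _ _ d3])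
    rw [hk, F, e3, e4]
    ring

theorem gain_small {n : ℕ} (T T' : ProbTournament n) (S : Finset (Fin n)) (hS : S.card ≤ 1)
    (hadj : Adjacent S T T') : rPS RSEB T' S - rPS RSEB T S = 0 := by
  have hp : ∀ o, T'.prob o = T.prob o := by
    intro o
    rw [prob_eq, prob_eq]
    refine Finset.prod_congr rfl (fun e _ => ?_)
    have hne : e.val.1 ≠ e.val.2 := ne_of_lt e.2
    have h1 := hadj e.val.1 e.val.2 (fun h => hne (Finset.card_le_one.1 hS _ h.1 _ h.2))
    have h2 := hadj e.val.2 e.val.1 (fun h => hne (Finset.card_le_one.1 hS _ h.2 _ h.1))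
    unfold wt
    rw [h1, h2]
  unfold rPS rP
  simp only [hp, sub_self]


theorem stmt11 (ε : ℝ) (hε : ε ∈ Set.Icc (0 : ℝ) (1/2)) :
    (∀ (n : ℕ) (T T' : ProbTournament n) (u v : Fin n), u ≠ v →
      WeaklyBounded ε n T → Adjacent {u, v} T T' →
      rPS RSEB T' {u, v} - rPS RSEB T {u, v} ≤ ε/3 + 2*ε^2/3)
    ∧ alph RSEB 2 (WeaklyBounded ε) = ε/3 + 2*ε^2/3 := by
  have h0 := hε.1
  refine ⟨fun n T T' u v huv hw hadj => upper ε hε.1 hε.2 T T' u v huv hw hadj, ?_⟩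
  have hub : ∀ x ∈ {x : ℝ | ∃ (n : ℕ) (T T' : ProbTournament n) (S : Finset (Fin n)),
      WeaklyBounded ε n T ∧ S.card ≤ 2 ∧ Adjacent S T T' ∧ x = rPS RSEB T' S - rPS RSEB T S},
      x ≤ ε/3 + 2*ε^2/3 := by
    rintro x ⟨n, T, T', S, hw, hS, hadj, rfl⟩
    rcases Nat.lt_or_ge S.card 2 with h | h
    · rw [gain_small T T' S (by omega) hadj]
      positivity
    · obtain ⟨u, v, huv, rfl⟩ := Finset.card_eq_two.1 (le_antisymm hS h)
      exact upper ε hε.1 hε.2 T T' u v huv hw hadj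
  obtain ⟨T, T', hw, hadj, he⟩ := lower ε hε.1 hε.2
  have hmem : ε/3 + 2*ε^2/3 ∈ {x : ℝ | ∃ (n : ℕ) (T T' : ProbTournament n) (S : Finset (Fin n)),
      WeaklyBounded ε n T ∧ S.card ≤ 2 ∧ Adjacent S T T' ∧ x = rPS RSEB T' S - rPS RSEB T S} :=
    ⟨3, T, T', {0, 1}, hw, Finset.card_le_two, hadj, he.symm⟩
  unfold alph
  exact le_antisymm (csSup_le ⟨_, hmem⟩ hub) (le_csSup ⟨_, hub⟩ hmem)
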